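/- Let (W,S) be a finite irreducible Coxeter system of rank n with Coxeter number h, and let MC(W) denote the number of maximal chains in the noncrossing partition lattice L_W. Then 2·MC(W) = h · ∑_{s∈S} MC(W_⟨s⟩), where MC(W_⟨s⟩) is the number of maximal chains in the noncrossing partition lattice of the parabolic subgroup W_⟨s⟩. -/

import Mathlib

open scoped BigOperators

section Defs

variable {G : Type*} [Group G]

/-- `t` is a reflection with respect to the generating set `S`:
a conjugate of an element of `S`. -/
def IsReflectionOf (S : Set G) (t : G) : Prop :=
  ∃ g : G, ∃ s ∈ S, t = g * s * g⁻¹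

/-- The absolute length of `w`: the minimal length of a word in the
reflections (conjugates of elements of `S`) whose product is `w`. -/
noncomputable def absLength (S : Set G) (w : G) : ℕ :=
  sInf {k | ∃ l : List G, (∀ t ∈ l, IsReflectionOf S t) ∧ l.length = k ∧ l.prod = w}

/-- The absolute order: `u ≤ v` iff `ℓ_T(u) + ℓ_T(u⁻¹v) = ℓ_T(v)`. -/
def absLe (S : Set G) (u v : G) : Prop :=
  absLength S u + absLength S (u⁻¹ * v) = absLength S v

/-- `c` is a Coxeter element with respect to the set `S` of simple reflections:
a product of all the elements of `S`, each occurring exactly once, in some order. -/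
def IsCoxeterElementOf (S : Set G) (c : G) : Prop :=
  ∃ l : List G, l.Nodup ∧ (∀ x, x ∈ l ↔ x ∈ S) ∧ l.prod = c

/-- The rank-selected multichain count `C_{(j₁,…,j_m)}(W)`: the number of multichains
`x₁ ≤ ⋯ ≤ x_{m-1}` in the interval `[1,c]` of the absolute order whose sequence of
rank jumps (prepending `1` and appending `c`) is given by `j`. -/
noncomputable def chainCount (S : Set G) (c : G) {m : ℕ} (j : Fin m → ℕ) : ℕ :=
  Nat.card {y : Fin (m + 1) → G //
    y 0 = 1 ∧ y (Fin.last m) = c ∧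
    (∀ i, absLe S (y i) c) ∧
    (∀ i : Fin m, absLe S (y i.castSucc) (y i.succ)) ∧
    (∀ i : Fin m, absLength S (y i.succ) = absLength S (y i.castSucc) + j i)}

end Defs

section Cox

variable {B : Type*} {W : Type*} [Group W] {M : CoxeterMatrix B}

/-- The set of simple reflections of a Coxeter system. -/
def simpleSet (cs : CoxeterSystem M W) : Set W := Set.range cs.simple

/-- A Coxeter system is irreducible if its set of simple reflections is nonempty and cannot
be partitioned into two nonempty subsets such that every simple reflection in one commutes
with every simple reflection in the other. -/
def IsIrreducibleCS (cs : CoxeterSystem M W) : Prop :=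
  Nonempty B ∧
    ∀ A : Set B, (∀ a ∈ A, ∀ b ∈ Aᶜ, Commute (cs.simple a) (cs.simple b)) →
      A = ∅ ∨ A = Set.univ

/-- The standard parabolic subgroup `W_⟨s⟩` generated by the simple reflections
other than `cs.simple s`. -/
def parabolic (cs : CoxeterSystem M W) (s : B) : Subgroup W :=
  Subgroup.closure (Set.range cs.simple \ {cs.simple s})

/-- The set of simple reflections of the parabolic subgroup `W_⟨s⟩`, viewed as
elements of that subgroup. -/
def parabolicGens (cs : CoxeterSystem M W) (s : B) : Set (parabolic cs s) :=
  {x | (x : W) ∈ Set.range cs.simple \ {cs.simple s}}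

end Cox

section MaxChains

variable {G : Type*} [Group G]

/-- The number of maximal chains `1 = x₀ < x₁ < ⋯ < x_n = c` (with `ℓ_T(x_i) = i` for
all `i`) in the noncrossing partition lattice `[1,c]` in the absolute order. -/
noncomputable def maxChainCount (S : Set G) (c : G) (n : ℕ) : ℕ :=
  Nat.card {y : Fin (n + 1) → G //
    y 0 = 1 ∧ y (Fin.last n) = c ∧
    (∀ i : Fin n, absLe S (y i.castSucc) (y i.succ)) ∧
    (∀ i : Fin (n + 1), absLength S (y i) = (i : ℕ))}

end MaxChains

section Factorizations

variable {G : Type*} [Group G] {S : Set G}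

theorem IsReflectionOf.conj {t : G} (ht : IsReflectionOf S t) (g : G) :
    IsReflectionOf S (g * t * g⁻¹) := by
  obtain ⟨x, s, hs, rfl⟩ := ht
  exact ⟨g * x, s, hs, by group⟩

theorem IsReflectionOf.mul_self (hS : ∀ s ∈ S, s * s = 1) {t : G} (ht : IsReflectionOf S t) :
    t * t = 1 := by
  obtain ⟨x, s, hs, rfl⟩ := ht
  have := hS s hs
  calc x * s * x⁻¹ * (x * s * x⁻¹) = x * (s * s) * x⁻¹ := by group
    _ = 1 := by rw [this]; group

theorem IsReflectionOf.inv_eq (hS : ∀ s ∈ S, s * s = 1) {t : G} (ht : IsReflectionOf S t) :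
    t⁻¹ = t :=
  inv_eq_of_mul_eq_one_left (ht.mul_self hS)

theorem absLength_prod_le {l : List G} (hl : ∀ t ∈ l, IsReflectionOf S t) :
    absLength S l.prod ≤ l.length :=
  Nat.sInf_le ⟨l, hl, rfl, rfl⟩

theorem exists_reflection_list_of_closure_eq_top (hS : ∀ s ∈ S, s * s = 1)
    (hgen : Subgroup.closure S = ⊤) (w : G) :
    ∃ l : List G, (∀ t ∈ l, IsReflectionOf S t) ∧ l.prod = w := by
  have hw : w ∈ (Subgroup.closure S).toSubmonoid := by rw [hgen]; trivial
  rw [Subgroup.closure_toSubmonoid] at hw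
  obtain ⟨l, hl, rfl⟩ := Submonoid.exists_list_of_mem_closure hw
  refine ⟨l, fun t ht => ?_, rfl⟩
  rcases hl t ht with h | h
  · exact ⟨1, t, h, by simp⟩
  · refine ⟨1, t⁻¹, h, ?_⟩
    have := inv_eq_of_mul_eq_one_left (hS _ h)
    rw [inv_inv] at this
    simpa using this

theorem exists_reflection_list_length_eq (hS : ∀ s ∈ S, s * s = 1)
    (hgen : Subgroup.closure S = ⊤) (w : G) :
    ∃ l : List G, (∀ t ∈ l, IsReflectionOf S t) ∧ l.length = absLength S w ∧ l.prod = w := by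
  obtain ⟨l, hl, hw⟩ := exists_reflection_list_of_closure_eq_top hS hgen w
  exact Nat.sInf_mem (s := {k | ∃ l : List G, (∀ t ∈ l, IsReflectionOf S t) ∧
    l.length = k ∧ l.prod = w}) ⟨l.length, l, hl, rfl, hw⟩

theorem absLength_mul_le (hS : ∀ s ∈ S, s * s = 1) (hgen : Subgroup.closure S = ⊤) (w : G) {t : G}
    (ht : IsReflectionOf S t) : absLength S (w * t) ≤ absLength S w + 1 := by
  obtain ⟨l, hl, hlen, hw⟩ := exists_reflection_list_length_eq hS hgen w
  have := absLength_prod_le (S := S) (l := l ++ [t]) (by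
    intro x hx
    rcases List.mem_append.1 hx with h | h
    · exact hl x h
    · rw [List.mem_singleton.1 h]; exact ht)
  simpa [hlen, hw] using this

theorem le_absLength_mul (hS : ∀ s ∈ S, s * s = 1) (hgen : Subgroup.closure S = ⊤) (w : G) {t : G}
    (ht : IsReflectionOf S t) : absLength S w ≤ absLength S (w * t) + 1 := by
  have := absLength_mul_le hS hgen (w * t) ht
  rwa [mul_assoc, ht.mul_self hS, mul_one] at this

theorem absLength_one : absLength S (1 : G) = 0 :=
  Nat.le_zero.1 (absLength_prod_le (S := S) (l := []) (by simp))

theorem eq_one_of_absLength_eq_zero (hS : ∀ s ∈ S, s * s = 1) (hgen : Subgroup.closure S = ⊤)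
    {w : G} (hw : absLength S w = 0) : w = 1 := by
  obtain ⟨l, -, hlen, rfl⟩ := exists_reflection_list_length_eq hS hgen w
  rw [hw, List.length_eq_zero_iff] at hlen
  simp [hlen]

theorem isReflectionOf_of_absLength_eq_one (hS : ∀ s ∈ S, s * s = 1)
    (hgen : Subgroup.closure S = ⊤) {w : G} (hw : absLength S w = 1) : IsReflectionOf S w := by
  obtain ⟨l, hl, hlen, rfl⟩ := exists_reflection_list_length_eq hS hgen w
  rw [hw, List.length_eq_one_iff] at hlen
  obtain ⟨t, rfl⟩ := hlen
  simpa using hl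

variable (S) in
/-- The condition cutting out the chains that `maxChainCount` counts. -/
def IsMaximalAbsChain (c : G) (n : ℕ) (y : Fin (n + 1) → G) : Prop :=
  y 0 = 1 ∧ y (Fin.last n) = c ∧ (∀ i : Fin n, absLe S (y i.castSucc) (y i.succ)) ∧
    (∀ i : Fin (n + 1), absLength S (y i) = (i : ℕ))

theorem isMaximalAbsChain_init (hS : ∀ s ∈ S, s * s = 1) (hgen : Subgroup.closure S = ⊤)
    {n : ℕ} {w : G} {y : Fin (n + 2) → G} (hy : IsMaximalAbsChain S w (n + 1) y) :
    IsReflectionOf S (w⁻¹ * y (Fin.last n).castSucc) ∧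
      IsMaximalAbsChain S (y (Fin.last n).castSucc) n (Fin.init y) := by
  obtain ⟨h0, hl, hle, hr⟩ := hy
  have h1 := hle (Fin.last n)
  have ha := hr (Fin.last n).castSucc
  have hb := hr (Fin.last n).succ
  rw [absLe, ha, hb] at h1
  simp only [Fin.val_castSucc, Fin.val_last, Fin.val_succ, Nat.add_left_cancel_iff] at h1
  have ht := isReflectionOf_of_absLength_eq_one hS hgen h1
  rw [Fin.succ_last, hl] at ht
  refine ⟨?_, h0, rfl, fun i => ?_, fun i => ?_⟩
  · have := ht.inv_eq hS
    rw [mul_inv_rev, inv_inv] at this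
    rwa [this]
  · have := hle i.castSucc
    rwa [Fin.succ_castSucc] at this
  · exact hr i.castSucc

theorem isMaximalAbsChain_snoc (hS : ∀ s ∈ S, s * s = 1) {n : ℕ} {w t : G}
    (hw : absLength S w = n + 1) (ht : IsReflectionOf S t) {y : Fin (n + 1) → G}
    (hy : IsMaximalAbsChain S (w * t) n y) :
    IsMaximalAbsChain S w (n + 1) (Fin.snoc (α := fun _ => G) y w) := by
  obtain ⟨h0, hl, hle, hr⟩ := hy
  have hwt : absLength S (w * t) = n := by rw [← hl, hr]; simp
  have ht1 : absLength S t = 1 := by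
    refine le_antisymm (by simpa using absLength_prod_le (S := S) (l := [t]) (by simpa using ht)) ?_
    by_contra hlt
    have h0 : absLength S t = 0 := by omega
    obtain ⟨l, hl', hlen, hprod⟩ := Nat.sInf_mem (s := {k | ∃ l : List G,
      (∀ t ∈ l, IsReflectionOf S t) ∧ l.length = k ∧ l.prod = t}) ⟨1, [t], by simpa using ht⟩
    change l.length = absLength S t at hlen
    rw [h0, List.length_eq_zero_iff] at hlen
    subst hlen
    rw [← hprod] at hwt
    simp at hwt
    omega
  refine ⟨?_, Fin.snoc_last .., fun i => ?_, fun i => ?_⟩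
  · rw [← h0, ← Fin.castSucc_zero, Fin.snoc_castSucc]
  · refine Fin.lastCases ?_ (fun i => ?_) i
    · rw [Fin.snoc_castSucc, Fin.succ_last, Fin.snoc_last, hl, absLe, hwt, hw, mul_inv_rev,
        inv_mul_cancel_right, ht.inv_eq hS, ht1]
    · rw [Fin.snoc_castSucc, Fin.succ_castSucc, Fin.snoc_castSucc]
      exact hle i
  · refine Fin.lastCases ?_ (fun i => ?_) i
    · simp [hw]
    · rw [Fin.snoc_castSucc]; simpa using hr i

theorem maxChainCount_eq_zero {n : ℕ} {w : G} (hw : absLength S w ≠ n) :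
    maxChainCount S w n = 0 := by
  rw [maxChainCount]
  exact @Nat.card_of_isEmpty _ ⟨fun y => hw (by rw [← y.2.2.1, y.2.2.2.2]; simp)⟩

theorem maxChainCount_zero_one : maxChainCount S (1 : G) 0 = 1 := by
  rw [maxChainCount]
  refine Nat.card_eq_one_iff_exists.2
    ⟨⟨fun _ => 1, rfl, rfl, fun i => i.elim0, fun i => by simp [absLength_one]⟩, fun y => ?_⟩
  refine Subtype.ext (funext fun i => ?_)
  rw [Fin.fin_one_eq_zero i]
  exact y.2.1

variable [Finite G]

variable (S) in
/-- The finite set of all reflections of a finite group with respect to `S`. -/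
noncomputable def reflectionFinset : Finset G := (Set.toFinite {t | IsReflectionOf S t}).toFinset

@[simp] theorem mem_reflectionFinset {t : G} : t ∈ reflectionFinset S ↔ IsReflectionOf S t := by
  simp [reflectionFinset]

variable (S) in
open Classical in
/-- The number of factorizations of `w` as a product of `n` reflections. -/
noncomputable def factorizationCount : ℕ → G → ℕ
  | 0, w => if w = 1 then 1 else 0
  | n + 1, w => ∑ t ∈ reflectionFinset S, factorizationCount n (w * t)

theorem exists_list_of_factorizationCount_ne_zero (hS : ∀ s ∈ S, s * s = 1) :
    ∀ (n : ℕ) (w : G), factorizationCount S n w ≠ 0 →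
      ∃ l : List G, (∀ t ∈ l, IsReflectionOf S t) ∧ l.length = n ∧ l.prod = w
  | 0, w, h => by
    have : w = 1 := by by_contra hw; simp [factorizationCount, hw] at h
    exact ⟨[], by simp [this]⟩
  | n + 1, w, h => by
    obtain ⟨t, ht, hne⟩ := Finset.exists_ne_zero_of_sum_ne_zero h
    rw [mem_reflectionFinset] at ht
    obtain ⟨l, hl, hlen, hw⟩ := exists_list_of_factorizationCount_ne_zero hS n _ hne
    refine ⟨l ++ [t], ?_, by simp [hlen], ?_⟩
    · intro x hx
      rcases List.mem_append.1 hx with h | h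
      · exact hl x h
      · rw [List.mem_singleton.1 h]; exact ht
    · rw [List.prod_append, hw, List.prod_singleton, mul_assoc, ht.mul_self hS, mul_one]

theorem factorizationCount_eq_zero_of_lt (hS : ∀ s ∈ S, s * s = 1) {n : ℕ} {w : G}
    (h : n < absLength S w) : factorizationCount S n w = 0 := by
  by_contra hne
  obtain ⟨l, hl, rfl, rfl⟩ := exists_list_of_factorizationCount_ne_zero hS n w hne
  exact absurd (absLength_prod_le hl) (not_le.2 h)

theorem factorizationCount_conj (g : G) :
    ∀ (n : ℕ) (w : G), factorizationCount S n (g * w * g⁻¹) = factorizationCount S n w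
  | 0, w => by
    have : g * w * g⁻¹ = 1 ↔ w = 1 := conj_eq_one_iff
    by_cases hw : w = 1
    · rw [this.2 hw, hw]
    · rw [factorizationCount, factorizationCount, if_neg hw, if_neg (mt this.1 hw)]
  | n + 1, w => by
    refine (Finset.sum_bij (fun t _ => g * t * g⁻¹) ?_ ?_ ?_ ?_).symm
    · intro t ht; simpa using (mem_reflectionFinset.1 ht).conj g
    · intro a _ b _ h; simpa using h
    · intro t ht
      refine ⟨g⁻¹ * t * g⁻¹⁻¹, by simpa using (mem_reflectionFinset.1 ht).conj g⁻¹, by group⟩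
    · intro t _
      rw [← factorizationCount_conj g n]
      congr 1; group

theorem factorizationCount_eq_of_isConj {v w : G} (h : IsConj v w) (n : ℕ) :
    factorizationCount S n v = factorizationCount S n w := by
  obtain ⟨g, rfl⟩ := isConj_iff.1 h
  exact (factorizationCount_conj g n v).symm

theorem maxChainCount_succ (hS : ∀ s ∈ S, s * s = 1) (hgen : Subgroup.closure S = ⊤) {n : ℕ}
    {w : G} (hw : absLength S w = n + 1) :
    maxChainCount S w (n + 1) = ∑ t ∈ reflectionFinset S, maxChainCount S (w * t) n := by
  let e : {y // IsMaximalAbsChain S w (n + 1) y} ≃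
      Σ t : reflectionFinset S, {y // IsMaximalAbsChain S (w * t) n y} :=
    { toFun := fun y => ⟨⟨w⁻¹ * y.1 (Fin.last n).castSucc,
          mem_reflectionFinset.2 (isMaximalAbsChain_init hS hgen y.2).1⟩,
        ⟨Fin.init y.1, by simpa using (isMaximalAbsChain_init hS hgen y.2).2⟩⟩
      invFun := fun p => ⟨_, isMaximalAbsChain_snoc hS hw (mem_reflectionFinset.1 p.1.2) p.2.2⟩
      left_inv := by
        rintro ⟨y, hy⟩
        simp only [Subtype.mk.injEq]
        conv_rhs => rw [← Fin.snoc_init_self y, hy.2.1]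
      right_inv := by
        rintro ⟨⟨t, ht⟩, ⟨y, hy⟩⟩
        have h1 : w⁻¹ * (Fin.snoc (α := fun _ => G) y w : Fin (n + 2) → G) (Fin.last n).castSucc
            = t := by
          rw [Fin.snoc_castSucc, hy.2.1, inv_mul_cancel_left]
        exact Sigma.subtype_ext (Subtype.ext h1) (Fin.init_snoc (α := fun _ => G) w y) }
  have h := Nat.card_congr e
  rw [Nat.card_sigma] at h
  rw [maxChainCount]
  refine h.trans ?_
  exact Finset.sum_coe_sort (reflectionFinset S) fun t => maxChainCount S (w * t) n

theorem maxChainCount_eq_factorizationCount (hS : ∀ s ∈ S, s * s = 1)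
    (hgen : Subgroup.closure S = ⊤) :
    ∀ {n : ℕ} {w : G}, n ≤ absLength S w → maxChainCount S w n = factorizationCount S n w
  | 0, w, _ => by
    by_cases hw : w = 1
    · subst hw; simp [maxChainCount_zero_one, factorizationCount]
    · rw [maxChainCount_eq_zero fun h => hw (eq_one_of_absLength_eq_zero hS hgen h)]
      simp [factorizationCount, hw]
  | n + 1, w, h => by
    rcases h.eq_or_lt with h | h
    · rw [maxChainCount_succ hS hgen h.symm, factorizationCount]
      refine Finset.sum_congr rfl fun t ht => maxChainCount_eq_factorizationCount hS hgen ?_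
      have := le_absLength_mul hS hgen w (mem_reflectionFinset.1 ht)
      omega
    · rw [maxChainCount_eq_zero h.ne', factorizationCount_eq_zero_of_lt hS h]

end Factorizations

section WordConjugation

variable {B : Type*} {r : B → B → Prop}

/-- The equivalence of words generated by cyclic rotation and by exchanging adjacent letters
related by `r`. -/
inductive WordConj (r : B → B → Prop) : List B → List B → Prop
  | refl (l : List B) : WordConj r l l
  | symm {l₁ l₂ : List B} : WordConj r l₁ l₂ → WordConj r l₂ l₁
  | trans {l₁ l₂ l₃ : List B} : WordConj r l₁ l₂ → WordConj r l₂ l₃ → WordConj r l₁ l₃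
  | rotate (a : B) (l : List B) : WordConj r (a :: l) (l ++ [a])
  | swap (u v : List B) {a b : B} : r a b → WordConj r (u ++ a :: b :: v) (u ++ b :: a :: v)

/-- Every nonempty finite set has a vertex with at most one neighbour in that set, where
neighbours are the distinct elements not related by `r`. -/
def HasLeaves (r : B → B → Prop) : Prop :=
  ∀ X : Finset B, X.Nonempty → ∃ s ∈ X, ∀ x ∈ X, ∀ y ∈ X, x ≠ s → y ≠ s →
    ¬ r s x → ¬ r s y → x = y

namespace WordConj

theorem perm {l₁ l₂ : List B} (h : WordConj r l₁ l₂) : l₁.Perm l₂ := by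
  induction h with
  | refl => exact .refl _
  | symm _ ih => exact ih.symm
  | trans _ _ ih₁ ih₂ => exact ih₁.trans ih₂
  | rotate a l => exact (List.perm_append_singleton a l).symm
  | swap u v _ => exact (List.Perm.swap _ _ _).append_left u

theorem isConj {H : Type*} [Group H] {f : B → H} (hf : ∀ a b, r a b → Commute (f a) (f b))
    {l₁ l₂ : List B} (h : WordConj r l₁ l₂) : IsConj (l₁.map f).prod (l₂.map f).prod := by
  induction h with
  | refl => exact .refl _
  | symm _ ih => exact ih.symm
  | trans _ _ ih₁ ih₂ => exact ih₁.trans ih₂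
  | rotate a l => exact isConj_iff.2 ⟨(f a)⁻¹, by simp⟩
  | swap u v hab =>
    rename_i a b
    have : (List.map f (u ++ a :: b :: v)).prod = (List.map f (u ++ b :: a :: v)).prod := by
      simp only [List.map_append, List.map_cons, List.prod_append, List.prod_cons]
      rw [← mul_assoc (f a), (hf _ _ hab).eq, mul_assoc]
    rw [this]

theorem append_comm (l₁ l₂ : List B) : WordConj r (l₁ ++ l₂) (l₂ ++ l₁) := by
  induction l₁ generalizing l₂ with
  | nil => simpa using WordConj.refl l₂
  | cons a l₁ ih =>
    refine (WordConj.rotate a (l₁ ++ l₂)).trans ?_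
    simpa using ih (l₂ ++ [a])

theorem shift (u l v : List B) {s : B} (h : ∀ x ∈ l, r s x) :
    WordConj r (u ++ s :: l ++ v) (u ++ l ++ s :: v) := by
  induction l generalizing u with
  | nil => simpa using WordConj.refl _
  | cons a l ih =>
    have h₁ := WordConj.swap u (l ++ v) (h a List.mem_cons_self)
    have h₂ := ih (u ++ [a]) fun x hx => h x (List.mem_cons_of_mem _ hx)
    refine .trans ?_ (h₁.trans (.trans ?_ (h₂.trans ?_)))
    all_goals simpa using WordConj.refl _

theorem cons {l₁ l₂ : List B} (h : WordConj r l₁ l₂) {s : B} (hnd : l₁.Nodup)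
    (hs : ∀ x ∈ l₁, ∀ y ∈ l₁, ¬ r s x → ¬ r s y → x = y) :
    WordConj r (s :: l₁) (s :: l₂) := by
  induction h with
  | refl => exact .refl _
  | symm h ih =>
    refine (ih (h.perm.nodup_iff.2 hnd) ?_).symm
    intro x hx y hy
    exact hs x (h.perm.mem_iff.1 hx) y (h.perm.mem_iff.1 hy)
  | trans h₁ _ ih₁ ih₂ =>
    refine (ih₁ hnd hs).trans (ih₂ (h₁.perm.nodup_iff.1 hnd) ?_)
    intro x hx y hy
    exact hs x (h₁.perm.mem_iff.2 hx) y (h₁.perm.mem_iff.2 hy)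
  | rotate a l =>
    by_cases hsa : r s a
    · exact (WordConj.swap [] l hsa).trans (WordConj.rotate a (s :: l))
    · have hl : ∀ x ∈ l, r s x := by
        intro x hx
        by_contra hsx
        have := hs x (List.mem_cons_of_mem _ hx) a List.mem_cons_self hsx hsa
        exact (List.nodup_cons.1 hnd).1 (this ▸ hx)
      have h := (WordConj.shift [a] l [] hl).symm
      refine (WordConj.rotate s (a :: l)).trans (.trans ?_ (WordConj.rotate a (s :: l)))
      simpa using h
  | swap u v hab => exact WordConj.swap (s :: u) v hab

theorem of_perm (hr : HasLeaves r) {l₁ l₂ : List B} (hnd : l₁.Nodup)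
    (hp : l₁.Perm l₂) : WordConj r l₁ l₂ := by
  classical
  induction hn : l₁.length generalizing l₁ l₂ with
  | zero =>
    rw [List.length_eq_zero_iff] at hn
    subst hn
    rw [hp.symm.eq_nil]
    exact .refl _
  | succ n ih =>
    obtain ⟨s, hs, hleaf⟩ := hr l₁.toFinset (by
      rw [List.toFinset_nonempty_iff]; rintro rfl; simp at hn)
    rw [List.mem_toFinset] at hs
    obtain ⟨a, b, rfl⟩ := List.append_of_mem hs
    obtain ⟨a', b', rfl⟩ := List.append_of_mem (hp.mem_iff.1 hs)
    have hnd' : (s :: (b ++ a)).Nodup := (append_comm (r := r) a (s :: b)).perm.nodup_iff.1 hnd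
    refine (append_comm a (s :: b)).trans (.trans ?_ (append_comm a' (s :: b')).symm)
    have hp' : (b ++ a).Perm (b' ++ a') := by
      refine List.Perm.cons_inv (a := s) ?_
      exact ((append_comm (r := r) a (s :: b)).perm.symm.trans hp).trans
        (append_comm (r := r) a' (s :: b')).perm
    refine cons (ih (List.nodup_cons.1 hnd').2 hp' ?_) (List.nodup_cons.1 hnd').2 ?_
    · simp only [List.length_append, List.length_cons] at hn ⊢; omega
    · intro x hx y hy
      have hne : ∀ z ∈ b ++ a, z ≠ s := fun z hz h => (List.nodup_cons.1 hnd').1 (h ▸ hz)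
      have hmem : ∀ z ∈ b ++ a, z ∈ (a ++ s :: b).toFinset := fun z hz => by
        simp only [List.mem_append, List.mem_toFinset, List.mem_cons] at hz ⊢; tauto
      exact hleaf x (hmem x hx) y (hmem y hy) (hne x hx) (hne y hy)

end WordConj

theorem HasLeaves.exists_two_coloring [Fintype B] (hr : HasLeaves r)
    (hsymm : ∀ a b, r a b → r b a) :
    ∃ col : B → Bool, ∀ a b, a ≠ b → ¬ r a b → col a ≠ col b := by
  classical
  suffices ∀ X : Finset B, ∃ col : B → Bool,
      ∀ a ∈ X, ∀ b ∈ X, a ≠ b → ¬ r a b → col a ≠ col b by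
    obtain ⟨col, h⟩ := this Finset.univ
    exact ⟨col, fun a b => h a (Finset.mem_univ _) b (Finset.mem_univ _)⟩
  intro X
  induction X using Finset.strongInduction with
  | H X ih =>
    rcases X.eq_empty_or_nonempty with rfl | hX
    · exact ⟨fun _ => true, by simp⟩
    obtain ⟨s, hs, hleaf⟩ := hr X hX
    obtain ⟨col, hcol⟩ := ih (X.erase s) (Finset.erase_ssubset hs)
    obtain ⟨v, hv⟩ : ∃ v : Bool, ∀ x ∈ X, x ≠ s → ¬ r s x → col x ≠ v := by
      by_cases h : ∃ x ∈ X, x ≠ s ∧ ¬ r s x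
      · obtain ⟨x, hx, hxs, hrx⟩ := h
        refine ⟨!col x, fun y hy hys hry => ?_⟩
        rw [hleaf x hx y hy hxs hys hrx hry]
        simp
      · push Not at h
        exact ⟨true, fun x hx hxs hrx => absurd (h x hx hxs) hrx⟩
    refine ⟨Function.update col s v, fun a ha b hb hab hrab => ?_⟩
    by_cases has : a = s
    · subst has
      rw [Function.update_self, Function.update_of_ne hab.symm]
      exact (hv b hb hab.symm hrab).symm
    · rw [Function.update_of_ne has]
      by_cases hbs : b = s
      · subst hbs
        rw [Function.update_self]
        exact hv a ha has fun h => hrab (hsymm _ _ h)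
      · rw [Function.update_of_ne hbs]
        exact hcol a (Finset.mem_erase.2 ⟨has, ha⟩) b (Finset.mem_erase.2 ⟨hbs, hb⟩) hab hrab

end WordConjugation

namespace CoxeterMatrix

variable {B : Type*} (M : CoxeterMatrix B)

/-- The Gram matrix of the simple roots in the geometric representation. -/
noncomputable def gram (i j : B) : ℝ := -Real.cos (Real.pi / M i j)

theorem gram_self (i : B) : M.gram i i = 1 := by simp [gram]

theorem gram_comm (i j : B) : M.gram i j = M.gram j i := by rw [gram, gram, M.symmetric]

theorem gram_eq_zero_or_le {i j : B} (hij : i ≠ j) :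
    (M i j = 2 ∧ M.gram i j = 0) ∨ M.gram i j ≤ -(1 / 2) := by
  have h1 : M i j ≠ 1 := M.off_diagonal i j hij
  rcases Nat.lt_or_ge (M i j) 3 with h | h
  · interval_cases hm : M i j
    · right; simp [gram, hm]; norm_num
    · exact absurd rfl h1
    · left; simp [gram, hm]
  · right
    have h3 : (3 : ℝ) ≤ M i j := by exact_mod_cast h
    rw [gram, neg_le_neg_iff, ← Real.cos_pi_div_three]
    apply Real.cos_le_cos_of_nonneg_of_le_pi
    · positivity
    · linarith [Real.pi_pos]
    · gcongr

theorem gram_nonpos {i j : B} (hij : i ≠ j) : M.gram i j ≤ 0 := by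
  rcases M.gram_eq_zero_or_le hij with h | h
  · exact h.2.le
  · linarith

variable [DecidableEq B]

/-- The simple root with index `i`. -/
def simpleRoot (i : B) : B → ℝ := Pi.single i 1

theorem simpleRoot_apply (i j : B) : simpleRoot i j = if j = i then (1 : ℝ) else 0 := by
  simp [simpleRoot, Pi.single_apply]

theorem simpleRoot_ne_zero (i : B) : (simpleRoot i : B → ℝ) ≠ 0 := by
  intro h; simpa [simpleRoot] using congrFun h i

variable [Fintype B]

theorem eq_sum_simpleRoot (x : B → ℝ) : x = ∑ i, x i • simpleRoot i := by
  ext j; simp [simpleRoot, Finset.sum_apply, Pi.single_apply]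

/-- The symmetric bilinear form of the geometric representation. -/
noncomputable def form : LinearMap.BilinForm ℝ (B → ℝ) := Matrix.toBilin' (Matrix.of M.gram)

theorem form_apply (x y : B → ℝ) : M.form x y = ∑ i, ∑ j, x i * M.gram i j * y j := by
  simp [form, Matrix.toBilin'_apply]

theorem form_comm (x y : B → ℝ) : M.form x y = M.form y x := by
  rw [form_apply, form_apply, Finset.sum_comm]
  refine Finset.sum_congr rfl fun i _ => Finset.sum_congr rfl fun j _ => ?_
  rw [M.gram_comm j i]; ring

theorem form_simpleRoot_left (i : B) (x : B → ℝ) :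
    M.form (simpleRoot i) x = ∑ j, M.gram i j * x j := by
  rw [form_apply, Finset.sum_eq_single i]
  · simp [simpleRoot]
  · intro j _ hj; simp [simpleRoot, hj]
  · simp

theorem form_simpleRoot (i j : B) : M.form (simpleRoot i) (simpleRoot j) = M.gram i j := by
  rw [form_simpleRoot_left, Finset.sum_eq_single j]
  · simp [simpleRoot]
  · intro k _ hk; simp [simpleRoot, hk]
  · simp

theorem form_eq_sum (x y : B → ℝ) : M.form x y = ∑ i, x i * M.form (simpleRoot i) y := by
  rw [form_apply]
  refine Finset.sum_congr rfl fun i _ => ?_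
  rw [form_simpleRoot_left, Finset.mul_sum]
  exact Finset.sum_congr rfl fun j _ => by ring

/-- The orthogonal reflection in the vector `v` (of norm one). -/
noncomputable def rootReflection (v : B → ℝ) : Module.End ℝ (B → ℝ) :=
  LinearMap.id - (2 : ℝ) • (M.form v).smulRight v

theorem rootReflection_apply (v x : B → ℝ) :
    M.rootReflection v x = x - (2 * M.form v x) • v := by
  simp [rootReflection, smul_smul]

variable {M} in
theorem form_rootReflection {v : B → ℝ} (hv : M.form v v = 1) (x y : B → ℝ) :
    M.form (M.rootReflection v x) (M.rootReflection v y) = M.form x y := by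
  simp only [rootReflection_apply, map_sub, map_smul, LinearMap.sub_apply, LinearMap.smul_apply,
    smul_eq_mul, hv, M.form_comm x v]
  ring

variable {M} in
theorem rootReflection_self {v : B → ℝ} (hv : M.form v v = 1) : M.rootReflection v v = -v := by
  rw [rootReflection_apply, hv]; module

variable {M} in
theorem rootReflection_mul_self {v : B → ℝ} (hv : M.form v v = 1) :
    M.rootReflection v * M.rootReflection v = 1 := by
  refine LinearMap.ext fun x => ?_
  simp only [Module.End.mul_apply, rootReflection_apply, map_sub, map_smul, hv,
    Module.End.one_apply]
  module

theorem form_simpleRoot_self (i : B) : M.form (simpleRoot i) (simpleRoot i) = 1 := by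
  rw [form_simpleRoot, gram_self]

theorem rotation_apply (i j : B) (x : ℝ) :
    (M.rootReflection (simpleRoot i) * M.rootReflection (simpleRoot j))
      (Real.sin (x + Real.pi / M i j) • simpleRoot i + Real.sin x • simpleRoot j) =
    Real.sin (x + 2 * (Real.pi / M i j) + Real.pi / M i j) • simpleRoot i +
      Real.sin (x + 2 * (Real.pi / M i j)) • simpleRoot j := by
  set θ := Real.pi / M i j with hθ
  have hg : M.gram i j = - Real.cos θ := rfl
  have hg' : M.gram j i = - Real.cos θ := by rw [gram_comm, hg]
  have key (y : ℝ) : Real.sin (y + θ + θ) = 2 * Real.cos θ * Real.sin (y + θ) - Real.sin y := by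
    have h1 := Real.sin_add (y + θ) θ
    have h2 := Real.sin_sub (y + θ) θ
    rw [add_sub_cancel_right] at h2
    rw [h1]; linarith
  have k1 := key x
  have k2 := key (x + θ)
  rw [show x + 2 * θ + θ = x + θ + θ + θ by ring, show x + 2 * θ = x + θ + θ by ring, k2, k1]
  simp only [Module.End.mul_apply, rootReflection_apply, map_add, map_sub, map_smul,
    form_simpleRoot, gram_self, hg, hg']
  module

theorem rotation_pow_apply (i j : B) (k : ℕ) (x : ℝ) :
    ((M.rootReflection (simpleRoot i) * M.rootReflection (simpleRoot j)) ^ k)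
      (Real.sin (x + Real.pi / M i j) • simpleRoot i + Real.sin x • simpleRoot j) =
    Real.sin (x + 2 * k * (Real.pi / M i j) + Real.pi / M i j) • simpleRoot i +
      Real.sin (x + 2 * k * (Real.pi / M i j)) • simpleRoot j := by
  induction k with
  | zero => simp
  | succ k ih =>
    rw [pow_succ', Module.End.mul_apply, ih, rotation_apply]
    push_cast
    congr 3 <;> ring

theorem isLiftable_rootReflection :
    M.IsLiftable fun i => M.rootReflection (simpleRoot i) := by
  intro i j
  rcases eq_or_ne i j with rfl | hij
  · rw [M.diagonal, pow_one, rootReflection_mul_self (M.form_simpleRoot_self i)]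
  by_cases h0 : M i j = 0
  · rw [h0, pow_zero]
  have h2 : 2 ≤ M i j := by have := M.off_diagonal i j hij; omega
  have h2' : (2 : ℝ) ≤ M i j := by exact_mod_cast h2
  set R := M.rootReflection (simpleRoot i) * M.rootReflection (simpleRoot j) with hR
  set θ := Real.pi / M i j with hθ
  have hsin : 0 < Real.sin θ := by
    apply Real.sin_pos_of_pos_of_lt_pi
    · have := Real.pi_pos; positivity
    · rw [hθ, div_lt_iff₀ (by linarith)]; nlinarith [Real.pi_pos]
  have hmθ : 2 * (M i j : ℝ) * θ = 2 * Real.pi := by rw [hθ]; field_simp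
  have hi : (R ^ M i j) (simpleRoot i) = simpleRoot i := by
    have := M.rotation_pow_apply i j (M i j) 0
    rw [← hR, ← hθ, hmθ] at this
    simp only [zero_add, Real.sin_zero, zero_smul, add_zero, map_smul, Real.sin_two_pi,
      add_comm (2 * Real.pi) θ, Real.sin_add_two_pi] at this
    exact smul_right_injective _ hsin.ne' this
  have hj : (R ^ M i j) (simpleRoot j) = simpleRoot j := by
    have := M.rotation_pow_apply i j (M i j) (-θ)
    rw [← hR, ← hθ, hmθ] at this
    simp only [neg_add_cancel, Real.sin_zero, zero_smul, zero_add, map_smul, Real.sin_neg,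
      Real.sin_add_two_pi, neg_add_cancel_comm, Real.sin_two_pi] at this
    exact smul_right_injective _ (neg_ne_zero.2 hsin.ne') this
  set g := M.gram i j with hg
  have hd : 1 - g * g ≠ 0 := by
    have : g = -Real.cos θ := rfl
    rw [this]
    have := Real.sin_sq_add_cos_sq θ
    nlinarith [sq_nonneg (Real.sin θ), mul_pos hsin hsin]
  refine LinearMap.ext fun x => ?_
  set p := M.form (simpleRoot i) x with hp
  set q := M.form (simpleRoot j) x with hq
  obtain ⟨a, ha'⟩ : ∃ a, a * (1 - g * g) = p - g * q := ⟨_, div_mul_cancel₀ _ hd⟩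
  obtain ⟨b, hb'⟩ : ∃ b, b * (1 - g * g) = q - g * p := ⟨_, div_mul_cancel₀ _ hd⟩
  set z := x - a • simpleRoot i - b • simpleRoot j with hz
  have hzi : M.form (simpleRoot i) z = 0 := by
    simp only [hz, map_sub, map_smul, smul_eq_mul, form_simpleRoot, gram_self, ← hg, ← hp]
    refine mul_left_cancel₀ hd ?_
    linear_combination -ha' - g * hb'
  have hzj : M.form (simpleRoot j) z = 0 := by
    simp only [hz, map_sub, map_smul, smul_eq_mul, form_simpleRoot, gram_self, M.gram_comm j i,
      ← hg, ← hq]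
    refine mul_left_cancel₀ hd ?_
    linear_combination -hb' - g * ha'
  have hRz : R z = z := by
    simp [hR, rootReflection_apply, hzi, hzj]
  have hRmz (k : ℕ) : (R ^ k) z = z := by
    induction k with
    | zero => simp
    | succ k ih => rw [pow_succ, Module.End.mul_apply, hRz, ih]
  have hx : x = z + a • simpleRoot i + b • simpleRoot j := by rw [hz]; abel
  change (R ^ M i j) x = x
  rw [hx]
  simp only [map_add, map_smul, hi, hj, hRmz]

end CoxeterMatrix

namespace CoxeterSystem

open CoxeterMatrix

variable {B W : Type*} [Fintype B] [DecidableEq B] [Group W] {M : CoxeterMatrix B}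
  (cs : CoxeterSystem M W)

/-- The geometric representation of a Coxeter system. -/
noncomputable def geomRep : W →* Module.End ℝ (B → ℝ) :=
  cs.lift ⟨fun i => M.rootReflection (simpleRoot i), M.isLiftable_rootReflection⟩

theorem geomRep_simple (i : B) : cs.geomRep (cs.simple i) = M.rootReflection (simpleRoot i) :=
  cs.lift_apply_simple _ i

theorem form_geomRep (w : W) (x y : B → ℝ) :
    M.form (cs.geomRep w x) (cs.geomRep w y) = M.form x y := by
  induction w using cs.simple_induction_left with
  | one => simp
  | mul_simple_left w i ih =>
    rw [map_mul, Module.End.mul_apply, Module.End.mul_apply, geomRep_simple,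
      form_rootReflection (M.form_simpleRoot_self i), ih]

theorem geomRep_inv_apply (w : W) (x : B → ℝ) : cs.geomRep w⁻¹ (cs.geomRep w x) = x := by
  rw [← Module.End.mul_apply, ← map_mul, inv_mul_cancel, map_one, Module.End.one_apply]

theorem geomRep_apply_inv (w : W) (x : B → ℝ) : cs.geomRep w (cs.geomRep w⁻¹ x) = x := by
  rw [← Module.End.mul_apply, ← map_mul, mul_inv_cancel, map_one, Module.End.one_apply]

/-- An invariant inner product for the geometric representation of a finite Coxeter group. -/
noncomputable def averageForm [Fintype W] : LinearMap.BilinForm ℝ (B → ℝ) :=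
  ∑ w : W, (Matrix.toBilin' (1 : Matrix B B ℝ)).compl₁₂ (cs.geomRep w) (cs.geomRep w)

theorem averageForm_apply [Fintype W] (x y : B → ℝ) :
    cs.averageForm x y = ∑ w : W, ∑ i, cs.geomRep w x i * cs.geomRep w y i := by
  simp [averageForm, LinearMap.sum_apply, Matrix.toBilin'_apply', dotProduct]

theorem averageForm_geomRep [Fintype W] (u : W) (x y : B → ℝ) :
    cs.averageForm (cs.geomRep u x) (cs.geomRep u y) = cs.averageForm x y := by
  rw [averageForm_apply, averageForm_apply]
  refine Fintype.sum_equiv (Equiv.mulRight u) _ _ fun w => ?_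
  simp [map_mul]

theorem averageForm_comm [Fintype W] (x y : B → ℝ) :
    cs.averageForm x y = cs.averageForm y x := by
  simp only [averageForm_apply, mul_comm]

theorem averageForm_pos [Fintype W] {x : B → ℝ} (hx : x ≠ 0) : 0 < cs.averageForm x x := by
  rw [averageForm_apply]
  obtain ⟨i, hi⟩ := Function.ne_iff.1 hx
  refine Finset.sum_pos' (fun w _ => Finset.sum_nonneg fun i _ => mul_self_nonneg _)
    ⟨1, Finset.mem_univ _, Finset.sum_pos' (fun i _ => mul_self_nonneg _)
      ⟨i, Finset.mem_univ _, ?_⟩⟩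
  simpa using mul_self_pos.2 hi

theorem averageForm_simpleRoot_right [Fintype W] (i : B) (x : B → ℝ) :
    cs.averageForm x (simpleRoot i) =
      M.form (simpleRoot i) x * cs.averageForm (simpleRoot i) (simpleRoot i) := by
  have h := cs.averageForm_geomRep (cs.simple i) x (simpleRoot i)
  rw [geomRep_simple, rootReflection_self (M.form_simpleRoot_self i), rootReflection_apply] at h
  simp only [map_sub, map_smul, map_neg, LinearMap.sub_apply, LinearMap.smul_apply,
    smul_eq_mul] at h
  linarith

theorem form_pos (cs : CoxeterSystem M W) [Finite W] {x : B → ℝ} (hx : x ≠ 0) :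
    0 < M.form x x := by
  cases nonempty_fintype W
  set d : B → ℝ := fun i => cs.averageForm (simpleRoot i) (simpleRoot i) with hd
  have hdpos (i : B) : 0 < d i := cs.averageForm_pos (simpleRoot_ne_zero i)
  have hg (i j : B) : cs.averageForm (simpleRoot i) (simpleRoot j) = M.gram i j * d j := by
    rw [averageForm_simpleRoot_right, form_simpleRoot, M.gram_comm]
  set y : B → ℝ := fun i => x i / √(d i) with hy
  have hy0 : y ≠ 0 := by
    obtain ⟨i, hi⟩ := Function.ne_iff.1 hx
    exact Function.ne_iff.2 ⟨i, div_ne_zero hi (Real.sqrt_pos.2 (hdpos i)).ne'⟩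
  have hpos := cs.averageForm_pos hy0
  convert hpos using 1
  rw [form_apply, eq_sum_simpleRoot y]
  simp only [map_sum, map_smul, LinearMap.sum_apply, LinearMap.smul_apply, smul_eq_mul, hg,
    Finset.mul_sum]
  rw [Finset.sum_comm]
  refine Finset.sum_congr rfl fun i _ => Finset.sum_congr rfl fun j _ => ?_
  by_cases h0 : M.gram j i = 0
  · simp [h0]
  have hdd : d i = d j := by
    have := cs.averageForm_comm (simpleRoot j) (simpleRoot i)
    rw [hg, hg, M.gram_comm i j] at this
    exact mul_left_cancel₀ h0 this
  have := Real.mul_self_sqrt (hdpos i).le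
  have hne := (Real.sqrt_pos.2 (hdpos i)).ne'
  simp only [hy]
  rw [hdd] at this hne ⊢
  field_simp
  linear_combination (x j * x i) * this

end CoxeterSystem

namespace CoxeterSystem

open CoxeterMatrix

variable {B W : Type*} [Group W] {M : CoxeterMatrix B}

theorem commute_simple_of_eq_two (cs : CoxeterSystem M W) {i j : B} (h : M i j = 2) :
    Commute (cs.simple i) (cs.simple j) := by
  have h1 := cs.simple_mul_simple_pow i j
  rw [h, sq] at h1
  have := eq_inv_of_mul_eq_one_left h1
  rwa [mul_inv_rev, inv_simple, inv_simple] at this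

theorem length_alternatingWord_mul_simple (cs : CoxeterSystem M W) (s t : B) (hM : M s t ≠ 0)
    {k : ℕ} (hk : M s t ≤ k) :
    cs.length (cs.wordProd (alternatingWord s t k) * cs.simple s) + 1 ≤ k := by
  induction k, hk using Nat.le_induction with
  | base =>
    have h1 : cs.wordProd (alternatingWord s t (M s t)) =
        cs.wordProd (alternatingWord t s (M s t)) := by
      have := cs.wordProd_braidWord_eq s t
      rwa [braidWord, braidWord, M.symmetric t s] at this
    obtain ⟨m, hm⟩ := Nat.exists_eq_succ_of_ne_zero hM
    rw [h1, hm, Nat.succ_eq_add_one, alternatingWord_succ, wordProd_concat,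
      simple_mul_simple_cancel_right]
    simpa using cs.length_wordProd_le (alternatingWord s t m)
  | succ k hk ih =>
    rw [alternatingWord_succ', wordProd_cons, mul_assoc]
    have := cs.length_mul_le (cs.simple (if Even k then t else s))
      (cs.wordProd (alternatingWord s t k) * cs.simple s)
    rw [length_simple] at this
    omega

variable [Fintype B] [DecidableEq B]

theorem coxeterMatrix_ne_zero (cs : CoxeterSystem M W) [Finite W] (i j : B) : M i j ≠ 0 := by
  intro h0
  have hij : i ≠ j := by rintro rfl; simp at h0
  have hx : (simpleRoot i + simpleRoot j : B → ℝ) ≠ 0 := fun h => by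
    simpa [simpleRoot_apply, hij] using congrFun h i
  have := cs.form_pos hx
  simp only [map_add, LinearMap.add_apply, form_simpleRoot, gram_self, M.gram_comm j i] at this
  simp [gram, h0] at this

theorem hasLeaves (cs : CoxeterSystem M W) [Finite W] : HasLeaves fun i j => M i j = 2 := by
  intro X hX
  by_contra! hcon
  set v : B → ℝ := fun i => if i ∈ X then 1 else 0 with hv
  have hv0 : v ≠ 0 := by
    obtain ⟨i, hi⟩ := hX
    exact Function.ne_iff.2 ⟨i, by simp [hv, hi]⟩
  refine absurd (cs.form_pos hv0) (not_lt.2 ?_)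
  rw [form_eq_sum]
  refine Finset.sum_nonpos fun i _ => ?_
  by_cases hi : i ∈ X
  · obtain ⟨x, hx, y, hy, hxi, hyi, hix, hiy, hxy⟩ := hcon i hi
    have hx' := (M.gram_eq_zero_or_le hxi.symm).resolve_left fun h => hix h.1
    have hy' := (M.gram_eq_zero_or_le hyi.symm).resolve_left fun h => hiy h.1
    have hsub : ({i, x, y} : Finset B) ⊆ X := by
      simp [Finset.insert_subset_iff, hi, hx, hy]
    have h1 : M.form (simpleRoot i) v = ∑ j ∈ X, M.gram i j := by
      simp [form_simpleRoot_left, hv, Finset.sum_ite_mem]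
    have h2 : ∑ j ∈ X \ {i, x, y}, M.gram i j ≤ 0 := Finset.sum_nonpos fun j hj =>
      M.gram_nonpos fun h => by simp [h] at hj
    have h3 : ∑ j ∈ ({i, x, y} : Finset B), M.gram i j = 1 + M.gram i x + M.gram i y := by
      rw [Finset.sum_insert (by simp [hxi.symm, hyi.symm]), Finset.sum_pair hxy, gram_self]; ring
    rw [h1, ← Finset.sum_sdiff hsub, h3]
    simp only [hv, hi, if_true, one_mul]
    linarith
  · simp [hv, hi]

theorem geomRep_alternatingWord (cs : CoxeterSystem M W) (s t : B) (k : ℕ) :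
    Real.sin (Real.pi / M s t) •
        cs.geomRep (cs.wordProd (alternatingWord s t k)) (simpleRoot s) =
      if Even k then
        Real.sin ((k + 1) * (Real.pi / M s t)) • simpleRoot s +
          Real.sin (k * (Real.pi / M s t)) • simpleRoot t
      else
        Real.sin (k * (Real.pi / M s t)) • simpleRoot s +
          Real.sin ((k + 1) * (Real.pi / M s t)) • simpleRoot t := by
  set θ := Real.pi / M s t with hθ
  have hg : M.gram s t = - Real.cos θ := rfl
  have hg' : M.gram t s = - Real.cos θ := by rw [gram_comm, hg]
  have key (y : ℝ) : Real.sin ((y + 1 + 1) * θ) =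
      2 * Real.cos θ * Real.sin ((y + 1) * θ) - Real.sin (y * θ) := by
    have h1 := Real.sin_add ((y + 1) * θ) θ
    have h2 := Real.sin_sub ((y + 1) * θ) θ
    rw [show (y + 1) * θ - θ = y * θ by ring] at h2
    rw [show (y + 1 + 1) * θ = (y + 1) * θ + θ by ring, h1]; linarith
  induction k with
  | zero => simp [alternatingWord]
  | succ k ih =>
    rw [alternatingWord_succ', wordProd_cons, map_mul, Module.End.mul_apply, ← map_smul, ih,
      geomRep_simple]
    push_cast
    by_cases hk : Even k
    · simp only [hk, if_true, Nat.even_add_one, not_true, if_false, rootReflection_apply, map_add,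
        map_smul, form_simpleRoot, gram_self, hg', key]
      module
    · simp only [hk, if_true, Nat.even_add_one, not_false_iff, if_false, rootReflection_apply,
        map_add, map_smul, form_simpleRoot, gram_self, hg, key]
      module

theorem geomRep_simpleRoot_nonneg (cs : CoxeterSystem M W) [Finite W] (w : W) (s : B)
    (hs : cs.length w < cs.length (w * cs.simple s)) : 0 ≤ cs.geomRep w (simpleRoot s) := by
  induction hn : cs.length w using Nat.strong_induction_on generalizing w s with
  | _ n ih =>
  by_cases hw1 : w = 1
  · subst hw1
    simp [simpleRoot, Pi.single_nonneg]
  obtain ⟨t, ht⟩ := cs.exists_rightDescent_of_ne_one hw1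
  have hts : s ≠ t := by
    rintro rfl
    exact absurd ht (not_lt.2 hs.le)
  set P : ℕ → Prop := fun k => ∃ v, w = v * cs.wordProd (alternatingWord s t k) ∧
    cs.length w = cs.length v + k with hP
  have hP1 : P 1 := by
    refine ⟨w * cs.simple t, by simp [alternatingWord], ?_⟩
    have := cs.length_mul_simple w t
    have ht' : cs.length (w * cs.simple t) < cs.length w := ht
    omega
  have hbound (k : ℕ) (hk : P k) : k ≤ cs.length w := by
    obtain ⟨v, -, hv⟩ := hk
    omega
  classical
  set k := Nat.findGreatest P (cs.length w) with hkdef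
  have hk1 : 1 ≤ k := Nat.le_findGreatest (hbound 1 hP1) hP1
  obtain ⟨v, hwv, hlen⟩ : P k := Nat.findGreatest_spec (hbound 1 hP1) hP1
  have hmax : ¬ P (k + 1) := fun h => by
    have := Nat.le_findGreatest (hbound _ h) h
    omega
  have hasc (x : B) (hx : x = s ∨ x = t) : cs.length v < cs.length (v * cs.simple x) := by
    by_contra hcon
    have hl := cs.length_mul_simple v x
    have hcases : x = (if Even k then t else s) ∨ x = if Even (k - 1) then t else s := by
      obtain ⟨m, hm⟩ := Nat.exists_eq_add_of_le' hk1
      simp only [hm, Nat.add_sub_cancel, Nat.even_add_one]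
      by_cases hme : Even m <;> simp [hme] <;> tauto
    rcases hcases with hx' | hx'
    · refine hmax ⟨v * cs.simple x, ?_, by omega⟩
      rw [alternatingWord_succ', wordProd_cons, ← hx', ← mul_assoc,
        simple_mul_simple_cancel_right, ← hwv]
    · have h1 : w = v * cs.simple x * cs.wordProd (alternatingWord s t (k - 1)) := by
        rw [hwv, show k = k - 1 + 1 by omega, alternatingWord_succ', wordProd_cons,
          Nat.add_sub_cancel, ← hx', mul_assoc]
      have h2 := cs.length_mul_le (v * cs.simple x) (cs.wordProd (alternatingWord s t (k - 1)))
      have h3 := cs.length_wordProd_le (alternatingWord s t (k - 1))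
      rw [length_alternatingWord] at h3
      rw [← h1] at h2
      omega
  have hkM : k < M s t := by
    by_contra hcon
    have h1 := cs.length_alternatingWord_mul_simple s t (cs.coxeterMatrix_ne_zero s t)
      (not_lt.1 hcon)
    have h2 := cs.length_mul_le v (cs.wordProd (alternatingWord s t k) * cs.simple s)
    rw [← mul_assoc, ← hwv] at h2
    omega
  have hvs := ih (cs.length v) (by omega) v s (hasc s (Or.inl rfl)) rfl
  have hvt := ih (cs.length v) (by omega) v t (hasc t (Or.inr rfl)) rfl
  have hM2 : 2 ≤ M s t := by
    have := M.off_diagonal s t hts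
    omega
  have hM0 : (0 : ℝ) < M s t := by exact_mod_cast (by omega : 0 < M s t)
  have hsin : 0 < Real.sin (Real.pi / M s t) := by
    apply Real.sin_pos_of_pos_of_lt_pi (by positivity)
    have : (2 : ℝ) ≤ M s t := by exact_mod_cast hM2
    rw [div_lt_iff₀ hM0]; nlinarith [Real.pi_pos]
  have hnn (m : ℕ) (hm : m ≤ M s t) : 0 ≤ Real.sin (m * (Real.pi / M s t)) := by
    apply Real.sin_nonneg_of_nonneg_of_le_pi (by positivity)
    have : (m : ℝ) ≤ M s t := by exact_mod_cast hm
    rw [mul_div_assoc', div_le_iff₀ hM0]; nlinarith [Real.pi_pos]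
  have h1 := cs.geomRep_alternatingWord s t k
  have hk' := hnn k hkM.le
  have hk1' := hnn (k + 1) hkM
  push_cast at hk1'
  have h2 : 0 ≤ Real.sin (Real.pi / M s t) • cs.geomRep w (simpleRoot s) := by
    rw [hwv, map_mul, Module.End.mul_apply, ← map_smul, h1]
    split_ifs <;> rw [map_add, map_smul, map_smul] <;>
      exact add_nonneg (smul_nonneg (by assumption) hvs) (smul_nonneg (by assumption) hvt)
  simpa [smul_smul, hsin.ne'] using smul_nonneg (inv_pos.2 hsin).le h2

theorem geomRep_simpleRoot_nonneg_or_nonpos (cs : CoxeterSystem M W) [Finite W] (w : W) (s : B) :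
    0 ≤ cs.geomRep w (simpleRoot s) ∨ cs.geomRep w (simpleRoot s) ≤ 0 := by
  rcases cs.length_mul_simple w s with h | h
  · exact Or.inl (cs.geomRep_simpleRoot_nonneg w s (by omega))
  · right
    have := cs.geomRep_simpleRoot_nonneg (w * cs.simple s) s (by simp; omega)
    rw [map_mul, Module.End.mul_apply, geomRep_simple,
      rootReflection_self (M.form_simpleRoot_self s), map_neg] at this
    exact neg_nonneg.1 this

/-- An element sending all simple roots to nonnegative vectors is trivial. -/
theorem eq_one_of_geomRep_simpleRoot_nonneg (cs : CoxeterSystem M W) [Finite W] {w : W}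
    (h : ∀ s, 0 ≤ cs.geomRep w (simpleRoot s)) : w = 1 := by
  by_contra hw
  obtain ⟨s, hs⟩ := cs.exists_rightDescent_of_ne_one hw
  have hs' : cs.length (w * cs.simple s) < cs.length w := hs
  have := cs.geomRep_simpleRoot_nonneg (w * cs.simple s) s (by simpa using hs')
  rw [map_mul, Module.End.mul_apply, geomRep_simple,
    rootReflection_self (M.form_simpleRoot_self s), map_neg] at this
  have h0 : cs.geomRep w (simpleRoot s) = 0 := le_antisymm (neg_nonneg.1 this) (h s)
  have := congrArg (cs.geomRep w⁻¹) h0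
  rw [geomRep_inv_apply, map_zero] at this
  exact simpleRoot_ne_zero s this

theorem geomRep_injective (cs : CoxeterSystem M W) [Finite W] :
    Function.Injective cs.geomRep := by
  rw [injective_iff_map_eq_one]
  intro w hw
  refine cs.eq_one_of_geomRep_simpleRoot_nonneg fun s => ?_
  rw [hw, Module.End.one_apply]
  simp [simpleRoot, Pi.single_nonneg]

theorem rootReflection_injOn {v w : B → ℝ} (hv : M.form v v = 1) (hw : M.form w w = 1)
    (h : M.rootReflection v = M.rootReflection w) : w = v ∨ w = -v := by
  have h1 := LinearMap.congr_fun h v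
  rw [rootReflection_self hv, rootReflection_apply] at h1
  have h2 : v = M.form w v • w := by
    have : (2 : ℝ) • v = (2 : ℝ) • (M.form w v • w) := by
      rw [smul_smul, two_smul]; nth_rewrite 2 [← neg_neg v]; rw [h1]; abel
    exact smul_right_injective _ (two_ne_zero) this
  have h3 : M.form w v * M.form w v = 1 := by
    have := congrArg (fun z => M.form z z) h2
    simp only [map_smul, LinearMap.smul_apply, smul_eq_mul, hv, hw] at this
    linarith
  rcases mul_self_eq_one_iff.1 h3 with h | h
  · left; rw [h, one_smul] at h2; exact h2.symm
  · right; rw [h] at h2; rw [h2]; simp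

theorem simple_injective (cs : CoxeterSystem M W) [Finite W] : Function.Injective cs.simple := by
  intro i j h
  have h1 := congrArg cs.geomRep h
  rw [geomRep_simple, geomRep_simple] at h1
  have := rootReflection_injOn (M.form_simpleRoot_self i) (M.form_simpleRoot_self j) h1
  by_contra hij
  rcases this with h | h <;> simpa [simpleRoot_apply, Ne.symm hij] using congrFun h j

end CoxeterSystem

namespace CoxeterSystem

open CoxeterMatrix

variable {B W : Type*} [Fintype B] [DecidableEq B] [Group W] {M : CoxeterMatrix B}

/-- A root is an image of a simple root under the geometric representation. -/
def IsRoot (cs : CoxeterSystem M W) (β : B → ℝ) : Prop :=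
  ∃ w s, cs.geomRep w (simpleRoot s) = β

theorem isRoot_simpleRoot (cs : CoxeterSystem M W) (s : B) : cs.IsRoot (simpleRoot s) :=
  ⟨1, s, by simp⟩

section IsRoot

variable {cs : CoxeterSystem M W} {β : B → ℝ}

theorem IsRoot.geomRep (hβ : cs.IsRoot β) (w : W) : cs.IsRoot (cs.geomRep w β) := by
  obtain ⟨u, s, rfl⟩ := hβ
  exact ⟨w * u, s, by simp⟩

theorem IsRoot.neg (hβ : cs.IsRoot β) : cs.IsRoot (-β) := by
  obtain ⟨u, s, rfl⟩ := hβ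
  refine ⟨u * cs.simple s, s, ?_⟩
  rw [map_mul, Module.End.mul_apply, geomRep_simple,
    rootReflection_self (M.form_simpleRoot_self s), map_neg]

theorem IsRoot.form_self (hβ : cs.IsRoot β) : M.form β β = 1 := by
  obtain ⟨u, s, rfl⟩ := hβ
  rw [form_geomRep, form_simpleRoot_self]

theorem IsRoot.ne_zero (hβ : cs.IsRoot β) : β ≠ 0 := by
  rintro rfl
  simpa using hβ.form_self

theorem IsRoot.nonneg_or_nonpos [Finite W] (hβ : cs.IsRoot β) : 0 ≤ β ∨ β ≤ 0 := by
  obtain ⟨u, s, rfl⟩ := hβ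
  exact cs.geomRep_simpleRoot_nonneg_or_nonpos u s

theorem IsRoot.eq_simpleRoot (hβ : cs.IsRoot β) (h : 0 ≤ β) {j : B}
    (hj : cs.geomRep (cs.simple j) β ≤ 0) : β = simpleRoot j := by
  have h1 : β = β j • simpleRoot j := by
    ext i
    rcases eq_or_ne i j with rfl | hij
    · simp [simpleRoot_apply]
    · have := hj i
      rw [geomRep_simple, rootReflection_apply] at this
      simp only [Pi.sub_apply, Pi.smul_apply, simpleRoot_apply, hij, if_false, smul_eq_mul,
        mul_zero, sub_zero, Pi.zero_apply] at this ⊢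
      exact le_antisymm this (h i)
  have h2 := hβ.form_self
  rw [h1] at h2
  simp only [map_smul, LinearMap.smul_apply, smul_eq_mul, form_simpleRoot_self, mul_one] at h2
  rcases mul_self_eq_one_iff.1 h2 with h3 | h3
  · rw [h1, h3, one_smul]
  · have := h j
    rw [h3] at this
    norm_num at this

end IsRoot

theorem rootReflection_geomRep (cs : CoxeterSystem M W) (w : W) (v : B → ℝ) :
    M.rootReflection (cs.geomRep w v) =
      cs.geomRep w * M.rootReflection v * cs.geomRep w⁻¹ := by
  refine LinearMap.ext fun x => ?_
  simp only [Module.End.mul_apply, rootReflection_apply, map_sub, map_smul, geomRep_apply_inv]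
  rw [← cs.form_geomRep w v, geomRep_apply_inv]

theorem geomRep_conj_simple (cs : CoxeterSystem M W) (w : W) (s : B) :
    cs.geomRep (w * cs.simple s * w⁻¹) = M.rootReflection (cs.geomRep w (simpleRoot s)) := by
  rw [rootReflection_geomRep, map_mul, map_mul, geomRep_simple]

theorem exists_root_of_isReflectionOf (cs : CoxeterSystem M W) {t : W}
    (ht : IsReflectionOf (simpleSet cs) t) :
    ∃ β, cs.IsRoot β ∧ cs.geomRep t = M.rootReflection β := by
  obtain ⟨g, _, ⟨s, rfl⟩, rfl⟩ := ht
  exact ⟨_, ⟨g, s, rfl⟩, cs.geomRep_conj_simple g s⟩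

theorem geomRep_wordProd_apply_of_notMem (cs : CoxeterSystem M W) {l : List B} {i : B}
    (hi : i ∉ l) (x : B → ℝ) : cs.geomRep (cs.wordProd l) x i = x i := by
  induction l with
  | nil => simp
  | cons j l ih =>
    simp only [List.mem_cons, not_or] at hi
    rw [wordProd_cons, map_mul, Module.End.mul_apply, geomRep_simple, rootReflection_apply]
    simp [simpleRoot_apply, hi.1, ih hi.2]

theorem geomRep_apply_of_mem_parabolic (cs : CoxeterSystem M W) {s : B} {w : W}
    (hw : w ∈ parabolic cs s) (x : B → ℝ) : cs.geomRep w x s = x s := by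
  induction hw using Subgroup.closure_induction generalizing x with
  | mem w hw =>
    obtain ⟨⟨j, rfl⟩, hj⟩ := hw
    have hjs : s ≠ j := by rintro rfl; exact hj rfl
    rw [geomRep_simple, rootReflection_apply]
    simp [simpleRoot_apply, hjs]
  | one => simp
  | mul u v _ _ hu hv => rw [map_mul, Module.End.mul_apply, hu, hv]
  | inv u _ hu =>
    rw [← hu (cs.geomRep u⁻¹ x), geomRep_apply_inv]

theorem simple_mem_parabolic (cs : CoxeterSystem M W) [Finite W] {s k : B} (hk : k ≠ s) :
    cs.simple k ∈ parabolic cs s :=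
  Subgroup.subset_closure ⟨⟨k, rfl⟩, fun h => hk (cs.simple_injective h)⟩

theorem IsRoot.exists_parabolic_of_nonneg {cs : CoxeterSystem M W} [Finite W] {β : B → ℝ}
    (hβ : cs.IsRoot β) (h0 : 0 ≤ β) {s : B} (hs : β s = 0) :
    ∃ u ∈ parabolic cs s, ∃ k, k ≠ s ∧ β = cs.geomRep u (simpleRoot k) := by
  obtain ⟨u, ⟨hu, hu0⟩, hmin⟩ := Set.exists_min_image
    {u : W | u ∈ parabolic cs s ∧ 0 ≤ cs.geomRep u β} (fun u => ∑ i, cs.geomRep u β i)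
    (Set.toFinite _) ⟨1, one_mem _, by simpa using h0⟩
  set γ := cs.geomRep u β with hγ
  have hγr : cs.IsRoot γ := hβ.geomRep u
  have hγs : γ s = 0 := by rw [hγ, cs.geomRep_apply_of_mem_parabolic hu, hs]
  obtain ⟨k, hk⟩ : ∃ k, 0 < γ k * M.form (simpleRoot k) γ := by
    by_contra! hcon
    have := hγr.form_self
    rw [form_eq_sum] at this
    linarith [Finset.sum_nonpos fun i (_ : i ∈ Finset.univ) => hcon i]
  have hks : k ≠ s := by
    rintro rfl
    rw [hγs, zero_mul] at hk
    exact lt_irrefl _ hk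
  have hf : 0 < M.form (simpleRoot k) γ := by
    by_contra! hcon
    exact absurd hk (not_lt.2 (mul_nonpos_of_nonneg_of_nonpos (hu0 k) hcon))
  rcases (hγr.geomRep (cs.simple k)).nonneg_or_nonpos with hp | hn
  · have hle := hmin (cs.simple k * u)
      ⟨mul_mem (cs.simple_mem_parabolic hks) hu, by
        rw [map_mul, Module.End.mul_apply, ← hγ]; exact hp⟩
    simp only [map_mul, Module.End.mul_apply, ← hγ, geomRep_simple, rootReflection_apply,
      Pi.sub_apply, Pi.smul_apply, smul_eq_mul, Finset.sum_sub_distrib, simpleRoot_apply] at hle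
    simp at hle
    linarith
  · refine ⟨u⁻¹, inv_mem hu, k, hks, ?_⟩
    rw [← hγr.eq_simpleRoot hu0 hn, hγ, geomRep_inv_apply]

/-- A reflection of `W` whose root has vanishing coordinate at `s` is a reflection of the
standard parabolic subgroup `W_⟨s⟩`. -/
theorem IsRoot.exists_isReflectionOf_parabolicGens {cs : CoxeterSystem M W} [Finite W] {β : B → ℝ}
    (hβ : cs.IsRoot β) {s : B} (hs : β s = 0) {t : W} (ht : cs.geomRep t = M.rootReflection β) :
    ∃ t' : parabolic cs s, IsReflectionOf (parabolicGens cs s) t' ∧ (t' : W) = t := by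
  have key (γ : B → ℝ) (hγ : cs.IsRoot γ) (hγ0 : 0 ≤ γ) (hγs : γ s = 0)
      (hγt : cs.geomRep t = M.rootReflection γ) :
      ∃ t' : parabolic cs s, IsReflectionOf (parabolicGens cs s) t' ∧ (t' : W) = t := by
    obtain ⟨u, hu, k, hk, rfl⟩ := hγ.exists_parabolic_of_nonneg hγ0 hγs
    refine ⟨⟨u, hu⟩ * ⟨cs.simple k, cs.simple_mem_parabolic hk⟩ * ⟨u, hu⟩⁻¹,
      ⟨⟨u, hu⟩, ⟨cs.simple k, cs.simple_mem_parabolic hk⟩,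
        ⟨⟨k, rfl⟩, fun h : cs.simple k = cs.simple s => hk (cs.simple_injective h)⟩, rfl⟩, ?_⟩
    apply cs.geomRep_injective
    rw [hγt, ← geomRep_conj_simple]
    rfl
  rcases hβ.nonneg_or_nonpos with h | h
  · exact key β hβ h hs ht
  · refine key (-β) hβ.neg (neg_nonneg.2 h) (by simp [hs]) ?_
    rw [ht]
    refine LinearMap.ext fun x => ?_
    simp [rootReflection_apply]

end CoxeterSystem

theorem exists_perm_map_eq {B H : Type*} {f : B → H} {m : List H} {L : List B}
    (h : m.Perm (L.map f)) : ∃ l : List B, l.map f = m ∧ l.Perm L := by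
  have h2 : List.Forall₂ (fun x b => x = f b) (L.map f) L := by
    rw [List.forall₂_map_left_iff, List.forall₂_same]; exact fun _ _ => rfl
  obtain ⟨l, h3, h4⟩ := List.perm_comp_forall₂ h h2
  refine ⟨l, ?_, h4⟩
  clear h h2 h4
  induction h3 with
  | nil => rfl
  | cons h _ ih => rw [List.map_cons, ih, h]

theorem finrank_span_image_le {α V : Type*} [AddCommGroup V] [Module ℝ V] {l : List α} (b : α → V) :
    Module.finrank ℝ (Submodule.span ℝ (b '' {t | t ∈ l})) ≤ l.length := by
  classical
  have h : b '' {t | t ∈ l} = ((l.map b).toFinset : Set V) := by ext; simp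
  rw [h]
  exact (finrank_span_finset_le_card _).trans ((List.toFinset_card_le _).trans (by simp))

namespace CoxeterSystem

open CoxeterMatrix

variable {B W : Type*} [Group W] {M : CoxeterMatrix B}

theorem mul_self_of_mem_simpleSet (cs : CoxeterSystem M W) :
    ∀ s ∈ simpleSet cs, s * s = 1 := by
  rintro _ ⟨i, rfl⟩
  exact cs.simple_mul_simple_self i

theorem closure_simpleSet (cs : CoxeterSystem M W) : Subgroup.closure (simpleSet cs) = ⊤ :=
  cs.subgroup_closure_range_simple

theorem mul_self_of_mem_parabolicGens (cs : CoxeterSystem M W) (s : B) :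
    ∀ x ∈ parabolicGens cs s, x * x = 1 := by
  rintro x ⟨⟨i, hi⟩, -⟩
  apply Subtype.ext
  rw [Subgroup.coe_mul, ← hi, simple_mul_simple_self, Subgroup.coe_one]

theorem closure_parabolicGens (cs : CoxeterSystem M W) (s : B) :
    Subgroup.closure (parabolicGens cs s) = ⊤ :=
  Subgroup.closure_closure_coe_preimage

theorem isReflectionOf_coe (cs : CoxeterSystem M W) {s : B} {t : parabolic cs s}
    (ht : IsReflectionOf (parabolicGens cs s) t) : IsReflectionOf (simpleSet cs) (t : W) := by
  obtain ⟨g, x, hx, rfl⟩ := ht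
  exact ⟨g, x, hx.1, by simp⟩

variable [Fintype B] [DecidableEq B]

/-- The moved space of a group element in the geometric representation. -/
noncomputable def movedSpace (cs : CoxeterSystem M W) (w : W) : Submodule ℝ (B → ℝ) :=
  LinearMap.range (cs.geomRep w - 1)

theorem movedSpace_mul_le (cs : CoxeterSystem M W) (u v : W) :
    cs.movedSpace (u * v) ≤ cs.movedSpace u ⊔ cs.movedSpace v := by
  rintro _ ⟨x, rfl⟩
  have : (cs.geomRep (u * v) - 1) x =
      (cs.geomRep u - 1) (cs.geomRep v x) + (cs.geomRep v - 1) x := by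
    simp
  rw [this]
  exact add_mem (Submodule.mem_sup_left ⟨_, rfl⟩) (Submodule.mem_sup_right ⟨_, rfl⟩)

theorem movedSpace_le_span (cs : CoxeterSystem M W) {t : W} {β : B → ℝ}
    (h : cs.geomRep t = M.rootReflection β) : cs.movedSpace t ≤ Submodule.span ℝ {β} := by
  rintro _ ⟨x, rfl⟩
  rw [Submodule.mem_span_singleton]
  exact ⟨-(2 * M.form β x), by simp [h, rootReflection_apply]⟩

/-- A product of reflections has moved space in the span of the corresponding roots. -/
theorem movedSpace_prod_le (cs : CoxeterSystem M W) {l : List W}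
    {b : W → B → ℝ} (hb : ∀ t ∈ l, cs.geomRep t = M.rootReflection (b t)) :
    cs.movedSpace l.prod ≤ Submodule.span ℝ (b '' {t | t ∈ l}) := by
  induction l with
  | nil => rintro _ ⟨x, rfl⟩; simp
  | cons t l ih =>
    rw [List.prod_cons]
    refine (cs.movedSpace_mul_le _ _).trans (sup_le ?_ ?_)
    · refine (cs.movedSpace_le_span (hb t (by simp))).trans (Submodule.span_mono ?_)
      rintro _ rfl
      exact ⟨t, by simp, rfl⟩
    · refine (ih fun t ht => hb t (by simp [ht])).trans (Submodule.span_mono ?_)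
      exact Set.image_mono fun x hx => List.mem_cons_of_mem _ hx

theorem exists_root_function (cs : CoxeterSystem M W) : ∃ b : W → B → ℝ,
    ∀ t, IsReflectionOf (simpleSet cs) t →
      cs.IsRoot (b t) ∧ cs.geomRep t = M.rootReflection (b t) := by
  choose! b hb using fun t => cs.exists_root_of_isReflectionOf (t := t)
  exact ⟨b, hb⟩

theorem finrank_movedSpace_prod_le (cs : CoxeterSystem M W) {l : List W}
    (hl : ∀ t ∈ l, IsReflectionOf (simpleSet cs) t) :
    Module.finrank ℝ (cs.movedSpace l.prod) ≤ l.length := by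
  obtain ⟨b, hb⟩ := cs.exists_root_function
  exact (Submodule.finrank_mono (cs.movedSpace_prod_le fun t ht => (hb t (hl t ht)).2)).trans
    (finrank_span_image_le b)

theorem finrank_movedSpace_le_absLength (cs : CoxeterSystem M W) (w : W) :
    Module.finrank ℝ (cs.movedSpace w) ≤ absLength (simpleSet cs) w := by
  obtain ⟨l, hl, hlen, rfl⟩ := exists_reflection_list_length_eq cs.mul_self_of_mem_simpleSet
    cs.closure_simpleSet w
  exact (cs.finrank_movedSpace_prod_le hl).trans hlen.le

theorem finrank_movedSpace_le_absLength_parabolicGens (cs : CoxeterSystem M W) {s : B}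
    (w : parabolic cs s) :
    Module.finrank ℝ (cs.movedSpace (w : W)) ≤ absLength (parabolicGens cs s) w := by
  obtain ⟨l, hl, hlen, rfl⟩ := exists_reflection_list_length_eq
    (cs.mul_self_of_mem_parabolicGens s) (cs.closure_parabolicGens s) w
  rw [← hlen, Subgroup.val_list_prod, ← List.length_map (as := l) ((↑) : parabolic cs s → W)]
  apply finrank_movedSpace_prod_le
  intro t ht
  obtain ⟨t', ht', rfl⟩ := List.mem_map.1 ht
  exact cs.isReflectionOf_coe (hl t' ht')

theorem form_simpleRoot_eq_zero_of_fixed (cs : CoxeterSystem M W) {l : List B} (hnd : l.Nodup)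
    {x : B → ℝ} (hx : cs.geomRep (cs.wordProd l) x = x) : ∀ i ∈ l, M.form (simpleRoot i) x = 0 := by
  induction l with
  | nil => simp
  | cons j l ih =>
    rw [List.nodup_cons] at hnd
    rw [wordProd_cons, map_mul, Module.End.mul_apply] at hx
    have h1 : cs.geomRep (cs.wordProd l) x = cs.geomRep (cs.simple j) x := by
      conv_rhs => rw [← hx]
      rw [← Module.End.mul_apply (cs.geomRep (cs.simple j)), ← map_mul, simple_mul_simple_self,
        map_one, Module.End.one_apply]
    have h2 := congrFun h1 j
    rw [geomRep_wordProd_apply_of_notMem cs hnd.1, geomRep_simple, rootReflection_apply] at h2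
    have h3 : M.form (simpleRoot j) x = 0 := by
      simp only [Pi.sub_apply, Pi.smul_apply, simpleRoot_apply, if_true, smul_eq_mul] at h2
      linarith
    rw [geomRep_simple, rootReflection_apply, h3, mul_zero, zero_smul, sub_zero] at h1
    intro i hi
    rcases List.mem_cons.1 hi with rfl | hi
    · exact h3
    · exact ih hnd.2 h1 i hi

theorem eq_zero_of_fixed (cs : CoxeterSystem M W) [Finite W] {l : List B} (hnd : l.Nodup)
    {x : B → ℝ} (hx : cs.geomRep (cs.wordProd l) x = x) (hsupp : ∀ i ∉ l, x i = 0) : x = 0 := by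
  by_contra h0
  refine (cs.form_pos h0).ne' ?_
  rw [form_eq_sum]
  refine Finset.sum_eq_zero fun i _ => ?_
  by_cases hi : i ∈ l
  · rw [cs.form_simpleRoot_eq_zero_of_fixed hnd hx i hi, mul_zero]
  · rw [hsupp i hi, zero_mul]

theorem length_le_finrank_movedSpace (cs : CoxeterSystem M W) [Finite W] {l : List B}
    (hnd : l.Nodup) : l.length ≤ Module.finrank ℝ (cs.movedSpace (cs.wordProd l)) := by
  set E := Function.ExtendByZero.linearMap ℝ ((↑) : {i // i ∈ l} → B) with hE
  set A := cs.geomRep (cs.wordProd l) - 1 with hA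
  have hEapp (y : {i // i ∈ l} → ℝ) : E y = Function.extend Subtype.val y (0 : B → ℝ) := rfl
  have hinj : Function.Injective (A ∘ₗ E) := by
    rw [injective_iff_map_eq_zero]
    intro y hy
    have h1 : cs.geomRep (cs.wordProd l) (E y) = E y := by
      simpa [hA, sub_eq_zero] using hy
    have h2 := cs.eq_zero_of_fixed hnd h1 fun i hi => by
      rw [hEapp, Function.extend_apply' _ _ _ (by rintro ⟨⟨a, ha⟩, rfl⟩; exact hi ha)]; rfl
    ext a
    have := congrFun h2 a
    rwa [hEapp, Subtype.val_injective.extend_apply] at this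
  have h1 := LinearMap.finrank_range_of_inj hinj
  rw [Module.finrank_fintype_fun_eq_card] at h1
  have h2 : Fintype.card {i // i ∈ l} = l.length := by
    rw [Fintype.card_of_subtype l.toFinset (by simp), List.toFinset_card_of_nodup hnd]
  rw [← h2, ← h1]
  exact Submodule.finrank_mono (LinearMap.range_comp_le_range E A)

theorem factorizationCount_parabolic (cs : CoxeterSystem M W) [Finite W] {s : B} :
    ∀ {n : ℕ} {w : parabolic cs s}, n ≤ Module.finrank ℝ (cs.movedSpace (w : W)) →
      factorizationCount (parabolicGens cs s) n w = factorizationCount (simpleSet cs) n (w : W)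
  | 0, w, _ => by
    have : (w : W) = 1 ↔ w = 1 := by norm_cast
    by_cases hw : w = 1
    · simp [factorizationCount, hw]
    · rw [factorizationCount, factorizationCount, if_neg hw, if_neg (mt this.1 hw)]
  | n + 1, w, h => by
    obtain ⟨b, hb⟩ := cs.exists_root_function
    have hstep (t : parabolic cs s) (ht : t ∈ reflectionFinset (parabolicGens cs s)) :
        factorizationCount (parabolicGens cs s) n (w * t) =
          factorizationCount (simpleSet cs) n ((w : W) * t) := by
      rw [mem_reflectionFinset] at ht
      have ht' := cs.isReflectionOf_coe ht
      apply factorizationCount_parabolic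
      have h1 : cs.movedSpace (w : W) ≤
          cs.movedSpace ((w * t : parabolic cs s) : W) ⊔ Submodule.span ℝ {b t} := by
        have := cs.movedSpace_mul_le ((w : W) * t) t
        rw [mul_assoc, ht'.mul_self cs.mul_self_of_mem_simpleSet, mul_one] at this
        exact this.trans (sup_le_sup_left (cs.movedSpace_le_span (hb _ ht').2) _)
      have h2 := Submodule.finrank_mono h1
      have h3 := Submodule.finrank_add_le_finrank_add_finrank
        (cs.movedSpace ((w * t : parabolic cs s) : W)) (Submodule.span ℝ {b t})
      have h4 := finrank_span_singleton (K := ℝ) (hb _ ht').1.ne_zero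
      omega
    rw [factorizationCount, factorizationCount, Finset.sum_congr rfl hstep]
    refine (Finset.sum_map _ ⟨Subtype.val, Subtype.val_injective⟩
      fun t : W => factorizationCount (simpleSet cs) n ((w : W) * t)).symm.trans ?_
    refine Finset.sum_subset ?_ ?_
    · intro t ht
      obtain ⟨t', ht', rfl⟩ := Finset.mem_map.1 ht
      rw [mem_reflectionFinset] at ht' ⊢
      exact cs.isReflectionOf_coe ht'
    · intro t ht hnot
      rw [mem_reflectionFinset] at ht
      by_contra hne
      obtain ⟨l, hl, hlen, hprod⟩ :=
        exists_list_of_factorizationCount_ne_zero cs.mul_self_of_mem_simpleSet _ _ hne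
      have hw : (w : W) = (l ++ [t]).prod := by
        rw [List.prod_append, hprod, List.prod_singleton, mul_assoc,
          ht.mul_self cs.mul_self_of_mem_simpleSet, mul_one]
      have hl' : ∀ u ∈ l ++ [t], IsReflectionOf (simpleSet cs) u := by
        intro u hu
        rcases List.mem_append.1 hu with hu | hu
        · exact hl u hu
        · rwa [List.mem_singleton.1 hu]
      have hle := cs.movedSpace_prod_le fun u hu => (hb u (hl' u hu)).2
      rw [← hw] at hle
      have hfin := finrank_span_image_le (l := l ++ [t]) b
      rw [List.length_append, hlen, List.length_singleton] at hfin
      have heq := Submodule.eq_of_le_of_finrank_le hle (hfin.trans h)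
      have hmem : b t ∈ cs.movedSpace (w : W) := by
        rw [heq]
        exact Submodule.subset_span ⟨t, by simp, rfl⟩
      have hs : b t s = 0 := by
        obtain ⟨x, hx⟩ := hmem
        rw [← hx]
        simp [cs.geomRep_apply_of_mem_parabolic w.2]
      obtain ⟨t', ht', rfl⟩ := (hb t ht).1.exists_isReflectionOf_parabolicGens hs (hb t ht).2
      exact hnot (Finset.mem_map.2 ⟨t', mem_reflectionFinset.2 ht', rfl⟩)

theorem exists_word_of_isCoxeterElementOf (cs : CoxeterSystem M W) [Finite W] {c : W}
    (hc : IsCoxeterElementOf (simpleSet cs) c) :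
    ∃ l : List B, l.Nodup ∧ (∀ i, i ∈ l) ∧ cs.wordProd l = c := by
  obtain ⟨m, hnd, hmem, rfl⟩ := hc
  have hp : m.Perm (Finset.univ.toList.map cs.simple) := by
    rw [List.perm_ext_iff_of_nodup hnd ((Finset.nodup_toList _).map cs.simple_injective)]
    intro x
    simp [hmem, simpleSet]
  obtain ⟨l, rfl, hl⟩ := exists_perm_map_eq hp
  exact ⟨l, hl.nodup_iff.2 (Finset.nodup_toList _), fun i => hl.mem_iff.2 (by simp), rfl⟩

theorem isConj_wordProd_of_perm (cs : CoxeterSystem M W) [Finite W] {l₁ l₂ : List B}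
    (hnd : l₁.Nodup) (hp : l₁.Perm l₂) : IsConj (cs.wordProd l₁) (cs.wordProd l₂) :=
  (WordConj.of_perm cs.hasLeaves hnd hp).isConj fun _ _ h => cs.commute_simple_of_eq_two h

theorem maxChainCount_simpleSet (cs : CoxeterSystem M W) [Finite W] {l : List B} (hnd : l.Nodup) :
    maxChainCount (simpleSet cs) (cs.wordProd l) l.length =
      factorizationCount (simpleSet cs) l.length (cs.wordProd l) :=
  maxChainCount_eq_factorizationCount cs.mul_self_of_mem_simpleSet cs.closure_simpleSet
    ((cs.length_le_finrank_movedSpace hnd).trans (cs.finrank_movedSpace_le_absLength _))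

/-- Maximal chains below a Coxeter element of `W_⟨s⟩` are counted by the reflection factorizations
in `W` of the product of any word in which every simple reflection except `s` occurs once. -/
theorem maxChainCount_parabolicGens (cs : CoxeterSystem M W) [Finite W] {s : B}
    {c' : parabolic cs s} (hc' : IsCoxeterElementOf (parabolicGens cs s) c') {l : List B}
    (hnd : l.Nodup) (hl : ∀ i, i ∈ l ↔ i ≠ s) :
    maxChainCount (parabolicGens cs s) c' l.length =
      factorizationCount (simpleSet cs) l.length (cs.wordProd l) := by
  set f : B → parabolic cs s := fun j =>
    if h : j ≠ s then ⟨cs.simple j, cs.simple_mem_parabolic h⟩ else 1 with hf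
  have hfv (j : B) (hj : j ≠ s) : (f j : W) = cs.simple j := by simp [hf, hj]
  have hval {k : List B} (hk : ∀ i ∈ k, i ≠ s) : ((k.map f).prod : W) = cs.wordProd k := by
    rw [Subgroup.val_list_prod, List.map_map, wordProd]
    exact congrArg _ (List.map_congr_left fun i hi => hfv i (hk i hi))
  obtain ⟨m, hmnd, hmem, rfl⟩ := hc'
  have hinj : ∀ x ∈ l, ∀ y ∈ l, f x = f y → x = y := fun x hx y hy hxy =>
    cs.simple_injective (by rw [← hfv x ((hl x).1 hx), ← hfv y ((hl y).1 hy), hxy])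
  have hp : m.Perm (l.map f) := by
    rw [List.perm_ext_iff_of_nodup hmnd (List.Nodup.map_on hinj hnd)]
    intro x
    rw [hmem, List.mem_map]
    constructor
    · rintro ⟨⟨j, hj⟩, hjs⟩
      have hjs' : j ≠ s := by rintro rfl; exact hjs hj.symm
      exact ⟨j, (hl j).2 hjs', Subtype.ext ((hfv j hjs').trans hj)⟩
    · rintro ⟨j, hj, rfl⟩
      have hjs := (hl j).1 hj
      exact ⟨⟨j, (hfv j hjs).symm⟩, fun h => hjs (cs.simple_injective ((hfv j hjs).symm.trans h))⟩
  obtain ⟨k, rfl, hk⟩ := exists_perm_map_eq hp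
  have hknd := hk.nodup_iff.2 hnd
  have hks : ∀ i ∈ k, i ≠ s := fun i hi => (hl i).1 (hk.mem_iff.1 hi)
  have hrank {k : List B} (hknd : k.Nodup) (hks : ∀ i ∈ k, i ≠ s) :
      k.length ≤ Module.finrank ℝ (cs.movedSpace ((k.map f).prod : W)) := by
    rw [hval hks]
    exact cs.length_le_finrank_movedSpace hknd
  have hconj : IsConj (k.map f).prod (l.map f).prod := by
    refine (WordConj.of_perm cs.hasLeaves hknd hk).isConj fun i j h => ?_
    by_cases hi : i = s
    · simp [hf, hi]
    by_cases hj : j = s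
    · simp [hf, hj]
    have := (cs.commute_simple_of_eq_two h).eq
    exact Subtype.ext (by simpa [hfv i hi, hfv j hj] using this)
  rw [← hk.length_eq, maxChainCount_eq_factorizationCount (cs.mul_self_of_mem_parabolicGens s)
    (cs.closure_parabolicGens s) ((hrank hknd hks).trans
      (cs.finrank_movedSpace_le_absLength_parabolicGens _)),
    factorizationCount_eq_of_isConj hconj, hk.length_eq,
    cs.factorizationCount_parabolic (hrank hnd fun i hi => (hl i).1 hi),
    hval fun i hi => (hl i).1 hi]

end CoxeterSystem

namespace CoxeterMatrix

variable {B : Type*} [Fintype B] [DecidableEq B] (M : CoxeterMatrix B)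

/-- The form of the geometric representation attains its minimum on the unit sphere at a
nonnegative vector. -/
theorem exists_nonneg_minimizer [Nonempty B] :
    ∃ p : B → ℝ, 0 ≤ p ∧ ∑ i, p i ^ 2 = 1 ∧
      ∀ y, M.form p p * ∑ i, y i ^ 2 ≤ M.form y y := by
  set K : Set (B → ℝ) := {x | ∑ i, x i ^ 2 = 1} with hK
  have hKc : IsCompact K := by
    refine (isCompact_Icc (a := (-1 : B → ℝ)) (b := 1)).of_isClosed_subset
      (isClosed_eq (by fun_prop) continuous_const) fun x hx => ?_
    have hle (i : B) : x i ^ 2 ≤ 1 := by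
      rw [← show ∑ i, x i ^ 2 = 1 from hx]
      exact Finset.single_le_sum (fun j _ => sq_nonneg (x j)) (Finset.mem_univ i)
    exact ⟨fun i => (abs_le.1 ((sq_le_one_iff_abs_le_one _).1 (hle i))).1,
      fun i => (abs_le.1 ((sq_le_one_iff_abs_le_one _).1 (hle i))).2⟩
  have hKne : K.Nonempty := by
    obtain ⟨i⟩ := ‹Nonempty B›
    refine ⟨simpleRoot i, ?_⟩
    simp [hK, simpleRoot_apply]
  have hcont : Continuous fun x : B → ℝ => M.form x x := by
    simp only [form_apply]
    fun_prop
  obtain ⟨x, hxK, hx⟩ := hKc.exists_isMinOn hKne hcont.continuousOn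
  have hpK : |x| ∈ K := by
    simpa [hK] using hxK
  have hle : M.form |x| |x| ≤ M.form x x := by
    rw [form_apply, form_apply]
    refine Finset.sum_le_sum fun i _ => Finset.sum_le_sum fun j _ => ?_
    rcases eq_or_ne i j with rfl | hij
    · simp [gram_self]
    · have h1 := M.gram_nonpos hij
      have h2 := le_abs_self (x i * x j)
      rw [abs_mul] at h2
      simp only [Pi.abs_apply]
      nlinarith
  refine ⟨|x|, abs_nonneg x, hpK, fun y => ?_⟩
  rcases eq_or_ne (∑ i, y i ^ 2) 0 with h0 | h0
  · have : y = 0 := by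
      ext i
      have := (Finset.sum_eq_zero_iff_of_nonneg fun i _ => sq_nonneg (y i)).1 h0 i
        (Finset.mem_univ i)
      simpa using this
    simp [this]
  · have hpos : 0 < ∑ i, y i ^ 2 :=
      lt_of_le_of_ne (Finset.sum_nonneg fun i _ => sq_nonneg (y i)) h0.symm
    set r := √(∑ i, y i ^ 2) with hr
    have hr0 : 0 < r := Real.sqrt_pos.2 hpos
    have hr2 : r ^ 2 = ∑ i, y i ^ 2 := Real.sq_sqrt hpos.le
    have hyK : r⁻¹ • y ∈ K := by
      simp only [hK, Set.mem_ofPred_eq, Pi.smul_apply, smul_eq_mul, mul_pow, ← Finset.mul_sum,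
        ← hr2]
      field_simp
    have h1 : M.form x x ≤ M.form (r⁻¹ • y) (r⁻¹ • y) := hx hyK
    simp only [map_smul, LinearMap.smul_apply, smul_eq_mul] at h1
    have h2 : M.form y y = r ^ 2 * (r⁻¹ * (r⁻¹ * M.form y y)) := by field_simp
    rw [← hr2, h2, mul_comm]
    exact mul_le_mul_of_nonneg_left (hle.trans h1) (sq_nonneg r)

/-- A nonnegative vector which is an eigenvector of the Gram matrix. -/
theorem exists_nonneg_eigenvector [Nonempty B] :
    ∃ (p : B → ℝ) (μ : ℝ), 0 ≤ p ∧ p ≠ 0 ∧ ∀ i, M.form (simpleRoot i) p = μ * p i := by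
  obtain ⟨p, hp0, hp1, hmin⟩ := M.exists_nonneg_minimizer
  refine ⟨p, M.form p p, hp0, ?_, fun i => ?_⟩
  · rintro rfl
    simp at hp1
  set μ := M.form p p with hμ
  have hq (t : ℝ) : 0 ≤ (1 - μ) * (t * t) + 2 * (M.form (simpleRoot i) p - μ * p i) * t + 0 := by
    have h1 := hmin (p + t • simpleRoot i)
    have h2 : ∑ j, (p + t • simpleRoot i : B → ℝ) j ^ 2 = 1 + 2 * t * p i + t ^ 2 := by
      have (j : B) : (p + t • simpleRoot i : B → ℝ) j ^ 2 =
          p j ^ 2 + if j = i then 2 * t * p i + t ^ 2 else 0 := by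
        simp only [Pi.add_apply, Pi.smul_apply, simpleRoot_apply, smul_eq_mul]
        split_ifs with h
        · rw [h]; ring
        · ring
      simp only [this, Finset.sum_add_distrib, hp1]
      simp; ring
    have h3 : M.form (p + t • simpleRoot i) (p + t • simpleRoot i) =
        μ + 2 * t * M.form (simpleRoot i) p + t ^ 2 := by
      simp only [map_add, map_smul, LinearMap.add_apply, LinearMap.smul_apply, smul_eq_mul,
        form_simpleRoot_self, M.form_comm p (simpleRoot i), ← hμ]
      ring
    rw [h2, h3] at h1
    nlinarith
  have h := discrim_le_zero hq
  rw [discrim] at h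
  have h2 : (M.form (simpleRoot i) p - μ * p i) ^ 2 ≤ 0 := by nlinarith
  have := pow_eq_zero_iff (two_ne_zero) |>.1 (le_antisymm h2 (sq_nonneg _))
  linarith

end CoxeterMatrix

namespace CoxeterSystem

open CoxeterMatrix

variable {B W : Type*} [Fintype B] [DecidableEq B] [Group W] {M : CoxeterMatrix B}

/-- The Perron–Frobenius eigenvector of the Gram matrix of an irreducible Coxeter system. -/
theorem exists_pos_eigenvector (cs : CoxeterSystem M W) (hirr : IsIrreducibleCS cs) :
    ∃ (p : B → ℝ) (r : ℝ), (∀ i, 0 < p i) ∧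
      ∀ i, 2 * M.form (simpleRoot i) p = (2 - r) * p i := by
  obtain ⟨_, hirr⟩ := hirr
  obtain ⟨p, μ, hp0, hp1, hp⟩ := M.exists_nonneg_eigenvector
  have hsum (i : B) : ∑ j ∈ Finset.univ.erase i, -(M.gram i j * p j) = (1 - μ) * p i := by
    have := hp i
    rw [form_simpleRoot_left, ← Finset.add_sum_erase _ _ (Finset.mem_univ i), gram_self] at this
    rw [Finset.sum_neg_distrib]
    linarith
  have hterm (i : B) : ∀ j ∈ Finset.univ.erase i, 0 ≤ -(M.gram i j * p j) := fun j hj =>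
    neg_nonneg.2 (mul_nonpos_of_nonpos_of_nonneg
      (M.gram_nonpos (Finset.ne_of_mem_erase hj).symm) (hp0 j))
  have hpos (i : B) : 0 < p i := by
    have hempty : {i | p i = 0} = (∅ : Set B) := by
      refine (hirr {i | p i = 0} fun a (ha : p a = 0) b (hb : p b ≠ 0) => ?_).resolve_right
        fun h => hp1 (funext fun i => (h ▸ Set.mem_univ i : i ∈ {i | p i = 0}))
      have hab : a ≠ b := by rintro rfl; exact hb ha
      have h1 := hsum a
      rw [ha, mul_zero, Finset.sum_eq_zero_iff_of_nonneg (hterm a)] at h1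
      have h2 := h1 b (Finset.mem_erase.2 ⟨hab.symm, Finset.mem_univ b⟩)
      have h3 : M.gram a b = 0 := by simpa [hb] using h2
      refine cs.commute_simple_of_eq_two ((M.gram_eq_zero_or_le hab).resolve_right ?_).1
      rw [h3]; norm_num
    refine lt_of_le_of_ne (hp0 i) fun h => ?_
    have : i ∈ {i | p i = 0} := h.symm
    rw [hempty] at this
    exact this
  exact ⟨p, 2 - 2 * μ, hpos, fun i => by rw [hp i]; ring⟩

end CoxeterSystem

section LinearRecurrence

/-- The sequence `u` with `u 0 = x`, `u 1 = y` and `u (n + 2) = r * u (n + 1) - u n`. -/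
def recSeq (r x y : ℝ) : ℕ → ℝ
  | 0 => x
  | 1 => y
  | n + 2 => r * recSeq r x y (n + 1) - recSeq r x y n

variable {r : ℝ}

theorem recSeq_add_two (x y : ℝ) (n : ℕ) :
    recSeq r x y (n + 2) = r * recSeq r x y (n + 1) - recSeq r x y n := rfl

theorem eq_recSeq {f : ℕ → ℝ} (hf : ∀ n, f (n + 2) = r * f (n + 1) - f n) (n : ℕ) :
    f n = recSeq r (f 0) (f 1) n := by
  suffices f n = recSeq r (f 0) (f 1) n ∧ f (n + 1) = recSeq r (f 0) (f 1) (n + 1) from this.1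
  induction n with
  | zero => exact ⟨rfl, rfl⟩
  | succ n ih => exact ⟨ih.2, by rw [hf, recSeq_add_two, ih.1, ih.2]⟩

theorem recSeq_eq_combination (x y : ℝ) (n : ℕ) :
    recSeq r x y n =
      y * recSeq r 0 1 n + x * (recSeq r 0 1 (n + 1) - r * recSeq r 0 1 n) := by
  have h := eq_recSeq (r := r)
    (f := fun n => y * recSeq r 0 1 n + x * (recSeq r 0 1 (n + 1) - r * recSeq r 0 1 n))
    (fun n => by simp only [recSeq_add_two]; ring) n
  rw [h]
  simp [recSeq]

theorem recSeq_shift (x y : ℝ) (d n : ℕ) :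
    recSeq r x y (n + d) = recSeq r (recSeq r x y d) (recSeq r x y (d + 1)) n := by
  have h := eq_recSeq (r := r) (f := fun n => recSeq r x y (n + d))
    (fun n => by
      rw [show n + 2 + d = n + d + 2 by ring, show n + 1 + d = n + d + 1 by ring,
        recSeq_add_two]) n
  simpa [add_comm 1 d] using h

theorem recSeq_smul (p x y : ℝ) (n : ℕ) : recSeq r (p * x) (p * y) n = p * recSeq r x y n := by
  rw [recSeq_eq_combination, recSeq_eq_combination x y]; ring

theorem recSeq_invariant (n : ℕ) :
    recSeq r 0 1 (n + 1) ^ 2 - r * recSeq r 0 1 (n + 1) * recSeq r 0 1 n +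
      recSeq r 0 1 n ^ 2 = 1 := by
  induction n with
  | zero => simp [recSeq]
  | succ n ih => rw [recSeq_add_two]; linarith

/-- The linear recurrence is reversible. -/
theorem recSeq_eq_of_add_eq {d : ℕ} :
    ∀ {n : ℕ}, recSeq r 0 1 (n + d) = recSeq r 0 1 n →
      recSeq r 0 1 (n + d + 1) = recSeq r 0 1 (n + 1) →
      recSeq r 0 1 d = 0 ∧ recSeq r 0 1 (d + 1) = 1
  | 0, h0, h1 => by simpa [recSeq] using And.intro h0 h1
  | n + 1, h0, h1 => by
    rw [show n + 1 + d = n + d + 1 by ring] at h0 h1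
    refine recSeq_eq_of_add_eq (n := n) ?_ h0
    rw [recSeq_add_two, recSeq_add_two, h0] at h1
    linarith

/-- If consecutive terms of the recurrence always have the same sign and some later term is not
positive, then the recurrence is periodic with even minimal period. -/
theorem exists_recSeq_period
    (hd : ∀ j, (0 ≤ recSeq r 0 1 j ∧ 0 ≤ recSeq r 0 1 (j + 1)) ∨
      (recSeq r 0 1 j ≤ 0 ∧ recSeq r 0 1 (j + 1) ≤ 0))
    (hz : ∃ j, 1 ≤ j ∧ recSeq r 0 1 j ≤ 0) :
    ∃ H, 1 ≤ H ∧ recSeq r 0 1 (2 * H) = 0 ∧ recSeq r 0 1 (2 * H + 1) = 1 ∧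
      ∀ d, 0 < d → d < 2 * H → ¬ (recSeq r 0 1 d = 0 ∧ recSeq r 0 1 (d + 1) = 1) := by
  classical
  set H := Nat.find hz with hH
  obtain ⟨hH1, hHz⟩ := Nat.find_spec hz
  rw [← hH] at hH1 hHz
  have hpos (j : ℕ) (h1 : 1 ≤ j) (hj : j < H) : 0 < recSeq r 0 1 j := by
    by_contra hcon
    exact Nat.find_min hz hj ⟨h1, not_lt.1 hcon⟩
  obtain ⟨m, hm⟩ : ∃ m, H = m + 2 := by
    have : H ≠ 1 := by
      intro h
      rw [h] at hHz
      norm_num [recSeq] at hHz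
    exact ⟨H - 2, by omega⟩
  have hm1 := hpos (m + 1) (by omega) (by omega)
  have hH0 : recSeq r 0 1 H = 0 := by
    rcases hd (m + 1) with h | h
    · refine le_antisymm hHz ?_
      rw [hm]; exact h.2
    · linarith [h.1]
  have hHs : recSeq r 0 1 (H + 1) = -1 := by
    have h1 := recSeq_invariant (r := r) H
    rw [hH0] at h1
    have h2 : recSeq r 0 1 (H + 1) = - recSeq r 0 1 (m + 1) := by
      have := recSeq_add_two (r := r) 0 1 (m + 1)
      rw [show m + 1 + 2 = H + 1 by omega, show m + 1 + 1 = H by omega, hH0] at this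
      rw [this]; ring
    have h3 : (recSeq r 0 1 (H + 1)) ^ 2 = 1 := by linarith
    rcases mul_self_eq_one_iff.1 ((sq _).symm.trans h3) with h | h
    · linarith
    · exact h
  have hanti (n : ℕ) : recSeq r 0 1 (n + H) = -recSeq r 0 1 n := by
    rw [recSeq_shift, hH0, hHs]
    have := recSeq_smul (r := r) (-1) 0 1 n
    simpa using this
  refine ⟨H, hH1, ?_, ?_, fun d hd0 hdH hcon => ?_⟩
  · rw [two_mul, hanti, hH0, neg_zero]
  · rw [two_mul, add_right_comm, hanti, hHs, neg_neg]
  · rcases lt_trichotomy d H with h | h | h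
    · exact (hpos d hd0 h).ne' hcon.1
    · rw [h, hHs] at hcon
      norm_num at hcon
    · have h1 := hanti (d - H)
      rw [Nat.sub_add_cancel h.le, hcon.1] at h1
      linarith [hpos (d - H) (by omega) (by omega)]

end LinearRecurrence

namespace CoxeterMatrix

variable {B : Type*} [Fintype B] [DecidableEq B]

/-- A two-colouring of the Coxeter graph together with a positive eigenvector of the Gram matrix
for the eigenvalue `1 - r / 2`. -/
structure BipartiteEigenvector (M : CoxeterMatrix B) where
  /-- The colour of a vertex. -/
  col : B → Bool
  /-- The coordinates of the eigenvector. -/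
  weight : B → ℝ
  /-- The corresponding eigenvalue of the adjacency matrix. -/
  r : ℝ
  gram_eq_zero : ∀ i j, i ≠ j → col i = col j → M.gram i j = 0
  weight_pos : ∀ i, 0 < weight i
  eigen : ∀ i, 2 * M.form (simpleRoot i) weight = (2 - r) * weight i

namespace BipartiteEigenvector

variable {M : CoxeterMatrix B} (D : BipartiteEigenvector M)

/-- The vertices of a given colour. -/
noncomputable def word (ε : Bool) : List B := (Finset.univ.filter fun i => D.col i = ε).toList

theorem mem_word {ε : Bool} {i : B} : i ∈ D.word ε ↔ D.col i = ε := by simp [word]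

theorem nodup_word (ε : Bool) : (D.word ε).Nodup := Finset.nodup_toList _

/-- The contribution of the vertices of a given colour to the pairing with the weights. -/
noncomputable def height (ε : Bool) (x : B → ℝ) : ℝ :=
  ∑ i, if D.col i = ε then D.weight i * x i else 0

theorem sum_weight_mul_gram_same (j : B) :
    (∑ i, if D.col i = D.col j then D.weight i * M.gram j i else 0) = D.weight j := by
  rw [Finset.sum_eq_single j]
  · simp [gram_self]
  · intro i _ hij
    split_ifs with h
    · rw [D.gram_eq_zero j i hij.symm h.symm, mul_zero]
    · rfl
  · simp

theorem two_mul_sum_weight_mul_gram_other {ε : Bool} {j : B} (hj : D.col j = !ε) :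
    2 * (∑ i, if D.col i = ε then D.weight i * M.gram j i else 0) = - D.r * D.weight j := by
  have h1 := D.eigen j
  have h2 := D.sum_weight_mul_gram_same j
  have h3 : M.form (simpleRoot j) D.weight =
      (∑ i, if D.col i = ε then D.weight i * M.gram j i else 0) +
        ∑ i, if D.col i = D.col j then D.weight i * M.gram j i else 0 := by
    rw [form_simpleRoot_left, ← Finset.sum_add_distrib]
    refine Finset.sum_congr rfl fun i _ => ?_
    rw [hj]
    cases ε <;> cases D.col i <;> simp [mul_comm]
  rw [h2] at h3
  rw [h3] at h1
  linarith

theorem two_mul_sum_weight_mul_form (ε : Bool) (x : B → ℝ) :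
    2 * (∑ i, if D.col i = ε then D.weight i * M.form (simpleRoot i) x else 0) =
      2 * D.height ε x - D.r * D.height (!ε) x := by
  have h1 : (∑ i, if D.col i = ε then D.weight i * M.form (simpleRoot i) x else 0) =
      ∑ j, x j * ∑ i, if D.col i = ε then D.weight i * M.gram j i else 0 := by
    simp only [form_simpleRoot_left, Finset.mul_sum]
    rw [Finset.sum_comm]
    refine Finset.sum_congr rfl fun i _ => ?_
    split_ifs
    · exact Finset.sum_congr rfl fun j _ => by rw [M.gram_comm j i]; ring
    · simp
  rw [h1, height, height, Finset.mul_sum, Finset.mul_sum, Finset.mul_sum,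
    ← Finset.sum_sub_distrib]
  refine Finset.sum_congr rfl fun j _ => ?_
  by_cases hj : D.col j = ε
  · have := D.sum_weight_mul_gram_same j
    rw [hj] at this
    rw [this]
    simp [hj]; ring
  · have hj' : D.col j = !ε := Bool.eq_not.2 hj
    have := D.two_mul_sum_weight_mul_gram_other hj'
    simp only [hj', if_true]
    cases ε <;> simp <;> linear_combination x j * this

theorem height_simpleRoot (ε : Bool) (i : B) :
    D.height ε (simpleRoot i) = if D.col i = ε then D.weight i else 0 := by
  rw [height, Finset.sum_eq_single i]
  · simp [simpleRoot_apply]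
  · intro j _ hj; simp [simpleRoot_apply, hj]
  · simp

theorem height_nonneg {x : B → ℝ} (hx : 0 ≤ x) (ε : Bool) : 0 ≤ D.height ε x := by
  refine Finset.sum_nonneg fun i _ => ?_
  split_ifs
  · exact mul_nonneg (D.weight_pos i).le (hx i)
  · exact le_rfl

theorem height_neg (ε : Bool) (x : B → ℝ) : D.height ε (-x) = - D.height ε x := by
  rw [height, height, ← Finset.sum_neg_distrib]
  refine Finset.sum_congr rfl fun i _ => ?_
  split_ifs <;> simp

variable {W : Type*} [Group W] (cs : CoxeterSystem M W)

theorem geomRep_wordProd_apply {l : List B} {ε : Bool} (hnd : l.Nodup)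
    (hl : ∀ i ∈ l, D.col i = ε) (x : B → ℝ) (j : B) :
    cs.geomRep (cs.wordProd l) x j = if j ∈ l then x j - 2 * M.form (simpleRoot j) x else x j := by
  induction l generalizing j with
  | nil => simp
  | cons k l ih =>
    rw [List.nodup_cons] at hnd
    have ih' := ih hnd.2 fun i hi => hl i (List.mem_cons_of_mem _ hi)
    have hk : M.form (simpleRoot k) (cs.geomRep (cs.wordProd l) x) = M.form (simpleRoot k) x := by
      rw [form_simpleRoot_left, form_simpleRoot_left]
      refine Finset.sum_congr rfl fun i _ => ?_
      rw [ih']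
      split_ifs with hi
      · rw [D.gram_eq_zero k i (by rintro rfl; exact hnd.1 hi)
          ((hl k (by simp)).trans (hl i (List.mem_cons_of_mem _ hi)).symm), zero_mul, zero_mul]
      · rfl
    rw [CoxeterSystem.wordProd_cons, map_mul, Module.End.mul_apply, CoxeterSystem.geomRep_simple,
      rootReflection_apply, hk, Pi.sub_apply, ih', Pi.smul_apply, simpleRoot_apply, smul_eq_mul]
    by_cases hjk : j = k
    · subst hjk; simp [hnd.1]
    · simp [hjk]

/-- The product of the simple reflections of a given colour. -/
noncomputable def half (ε : Bool) : W := cs.wordProd (D.word ε)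

/-- The bipartite Coxeter element. -/
noncomputable def coxeter : W := D.half cs true * D.half cs false

theorem geomRep_half_apply (ε : Bool) (x : B → ℝ) (j : B) :
    cs.geomRep (D.half cs ε) x j =
      if D.col j = ε then x j - 2 * M.form (simpleRoot j) x else x j := by
  rw [half, D.geomRep_wordProd_apply cs (D.nodup_word ε) fun i hi => D.mem_word.1 hi]
  simp only [D.mem_word]

theorem height_half (ε : Bool) (x : B → ℝ) :
    D.height ε (cs.geomRep (D.half cs ε) x) = -D.height ε x + D.r * D.height (!ε) x := by
  have h1 := D.two_mul_sum_weight_mul_form ε x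
  have h2 : D.height ε (cs.geomRep (D.half cs ε) x) = D.height ε x -
      2 * (∑ i, if D.col i = ε then D.weight i * M.form (simpleRoot i) x else 0) := by
    rw [height, height, Finset.mul_sum, ← Finset.sum_sub_distrib]
    refine Finset.sum_congr rfl fun i _ => ?_
    rw [D.geomRep_half_apply cs]
    split_ifs <;> ring
  rw [h2, h1]; ring

theorem height_half_not (ε : Bool) (x : B → ℝ) :
    D.height (!ε) (cs.geomRep (D.half cs ε) x) = D.height (!ε) x := by
  rw [height, height]
  refine Finset.sum_congr rfl fun i _ => ?_
  rw [D.geomRep_half_apply cs]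
  cases ε <;> cases D.col i <;> simp

theorem height_coxeter_pow (x : B → ℝ) (k : ℕ) :
    D.height false (cs.geomRep (D.coxeter cs ^ k) x) =
        recSeq D.r (D.height false x) (D.height true x) (2 * k) ∧
      D.height true (cs.geomRep (D.coxeter cs ^ k) x) =
        recSeq D.r (D.height false x) (D.height true x) (2 * k + 1) := by
  induction k with
  | zero => simp [recSeq]
  | succ k ih =>
    rw [pow_succ', map_mul, Module.End.mul_apply]
    set y := cs.geomRep (D.coxeter cs ^ k) x
    have h1 := D.height_half cs false y
    have h2 := D.height_half_not cs false y
    have h3 := D.height_half cs true (cs.geomRep (D.half cs false) y)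
    have h4 := D.height_half_not cs true (cs.geomRep (D.half cs false) y)
    simp only [Bool.not_true, Bool.not_false] at h1 h2 h3 h4
    rw [coxeter, map_mul, Module.End.mul_apply, h3, h4, h1, h2, ih.1, ih.2,
      show 2 * (k + 1) = 2 * k + 2 by ring, show 2 * k + 2 + 1 = 2 * k + 1 + 2 by ring,
      recSeq_add_two _ _ (2 * k + 1), recSeq_add_two _ _ (2 * k)]
    constructor <;> ring

/-- Representatives of the orbits of the bipartite Coxeter element on roots. -/
noncomputable def leader (i : B) : B → ℝ :=
  if D.col i = true then simpleRoot i else cs.geomRep (D.half cs true) (simpleRoot i)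

/-- The parity of the colour of a vertex. -/
def offset (i : B) : ℕ := if D.col i = true then 0 else 1

theorem isRoot_leader (i : B) : cs.IsRoot (D.leader cs i) := by
  rw [leader]
  split_ifs
  · exact cs.isRoot_simpleRoot i
  · exact (cs.isRoot_simpleRoot i).geomRep _

theorem height_leader (i : B) :
    D.height false (D.leader cs i) = D.weight i * recSeq D.r 0 1 (D.offset i) ∧
      D.height true (D.leader cs i) = D.weight i * recSeq D.r 0 1 (D.offset i + 1) := by
  rw [leader, offset]
  split_ifs with h
  · simp [height_simpleRoot, h, recSeq]
  · have h1 := D.height_half cs true (simpleRoot i)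
    have h2 := D.height_half_not cs true (simpleRoot i)
    simp only [Bool.not_true] at h1 h2
    rw [h1, h2]
    simp [height_simpleRoot, Bool.eq_false_of_not_eq_true h, recSeq, mul_comm]

theorem height_coxeter_pow_leader (k : ℕ) (i : B) :
    D.height false (cs.geomRep (D.coxeter cs ^ k) (D.leader cs i)) =
        D.weight i * recSeq D.r 0 1 (2 * k + D.offset i) ∧
      D.height true (cs.geomRep (D.coxeter cs ^ k) (D.leader cs i)) =
        D.weight i * recSeq D.r 0 1 (2 * k + D.offset i + 1) := by
  have h := D.height_coxeter_pow cs (D.leader cs i) k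
  rw [(D.height_leader cs i).1, (D.height_leader cs i).2, recSeq_smul, recSeq_smul,
    ← recSeq_shift, ← recSeq_shift] at h
  rwa [add_right_comm] at h

variable {cs} in
theorem height_sign [Finite W] {β : B → ℝ} (hβ : cs.IsRoot β) :
    (∀ ε, 0 ≤ D.height ε β) ∨ ∀ ε, D.height ε β ≤ 0 := by
  rcases hβ.nonneg_or_nonpos with h | h
  · exact Or.inl (D.height_nonneg h)
  · refine Or.inr fun ε => ?_
    have := D.height_nonneg (neg_nonneg.2 h) ε
    rw [height_neg] at this
    linarith

theorem r_eq_zero_of_forall_col_eq [Nonempty B] {ε : Bool} (h : ∀ i, D.col i = ε) : D.r = 0 := by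
  obtain ⟨j⟩ := ‹Nonempty B›
  have h1 := D.two_mul_sum_weight_mul_gram_other (ε := !ε) (j := j) (by simp [h])
  have h2 : (∑ i, if D.col i = !ε then D.weight i * M.gram j i else 0) = 0 :=
    Finset.sum_eq_zero fun i _ => by simp [h]
  rw [h2] at h1
  have := (D.weight_pos j).ne'
  simpa [this] using h1

theorem recSeq_sign (cs : CoxeterSystem M W) [Finite W] [Nonempty B] (j : ℕ) :
    (0 ≤ recSeq D.r 0 1 j ∧ 0 ≤ recSeq D.r 0 1 (j + 1)) ∨
      (recSeq D.r 0 1 j ≤ 0 ∧ recSeq D.r 0 1 (j + 1) ≤ 0) := by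
  by_cases h : ∃ i, D.offset i = j % 2
  · obtain ⟨i, hi⟩ := h
    have h1 := D.height_coxeter_pow_leader cs (j / 2) i
    rw [hi, Nat.div_add_mod] at h1
    have hp := D.weight_pos i
    rcases D.height_sign ((D.isRoot_leader cs i).geomRep (D.coxeter cs ^ (j / 2))) with h2 | h2
    · have h3 := h2 false
      have h4 := h2 true
      rw [h1.1] at h3
      rw [h1.2] at h4
      exact Or.inl ⟨nonneg_of_mul_nonneg_right h3 hp, nonneg_of_mul_nonneg_right h4 hp⟩
    · have h3 := h2 false
      have h4 := h2 true
      rw [h1.1] at h3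
      rw [h1.2] at h4
      exact Or.inr ⟨nonpos_of_mul_nonpos_right h3 hp, nonpos_of_mul_nonpos_right h4 hp⟩
  · push Not at h
    have hcol : ∃ ε, ∀ i, D.col i = ε := by
      rcases Nat.mod_two_eq_zero_or_one j with hj | hj
      · refine ⟨false, fun i => ?_⟩
        have := h i
        rw [hj, offset] at this
        simpa using this
      · refine ⟨true, fun i => ?_⟩
        have := h i
        rw [hj, offset] at this
        simpa using this
    obtain ⟨ε, hε⟩ := hcol
    have hr := D.r_eq_zero_of_forall_col_eq hε
    have hzero : recSeq D.r 0 1 j = 0 ∨ recSeq D.r 0 1 (j + 1) = 0 := by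
      clear h
      induction j with
      | zero => exact Or.inl rfl
      | succ j ih =>
        rw [recSeq_add_two, hr] at *
        rcases ih with h | h
        · right; rw [h]; ring
        · left; exact h
    rcases hzero with h0 | h0
    · rw [h0]
      rcases le_total 0 (recSeq D.r 0 1 (j + 1)) with h1 | h1
      · exact Or.inl ⟨le_rfl, h1⟩
      · exact Or.inr ⟨le_rfl, h1⟩
    · rw [h0]
      rcases le_total 0 (recSeq D.r 0 1 j) with h1 | h1
      · exact Or.inl ⟨h1, le_rfl⟩
      · exact Or.inr ⟨h1, le_rfl⟩

theorem recSeq_orderOf_coxeter [Nonempty B] :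
    recSeq D.r 0 1 (2 * orderOf (D.coxeter cs)) = 0 := by
  obtain ⟨i⟩ := ‹Nonempty B›
  have h1 := D.height_coxeter_pow_leader cs (orderOf (D.coxeter cs)) i
  rw [pow_orderOf_eq_one, map_one, Module.End.one_apply, (D.height_leader cs i).1,
    (D.height_leader cs i).2] at h1
  have hp := (D.weight_pos i).ne'
  have h2 := mul_left_cancel₀ hp h1.1
  have h3 := mul_left_cancel₀ hp h1.2
  rw [add_comm] at h2
  rw [show 2 * orderOf (D.coxeter cs) + D.offset i + 1 =
    D.offset i + 2 * orderOf (D.coxeter cs) + 1 by ring] at h3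
  exact (recSeq_eq_of_add_eq h2.symm h3.symm).1

end BipartiteEigenvector

end CoxeterMatrix

namespace CoxeterMatrix

namespace BipartiteEigenvector

variable {B : Type*} [Fintype B] [DecidableEq B] {M : CoxeterMatrix B} (D : BipartiteEigenvector M)
variable {W : Type*} [Group W] (cs : CoxeterSystem M W)

theorem orderOf_coxeter_le [Finite W] {H : ℕ} (hH : 1 ≤ H) (h0 : recSeq D.r 0 1 (2 * H) = 0)
    (h1 : recSeq D.r 0 1 (2 * H + 1) = 1) : orderOf (D.coxeter cs) ≤ H := by
  refine orderOf_le_of_pow_eq_one hH (cs.eq_one_of_geomRep_simpleRoot_nonneg fun i => ?_)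
  have h2 := D.height_coxeter_pow cs (simpleRoot i) H
  rw [recSeq_eq_combination (D.height false _) _ (2 * H),
    recSeq_eq_combination (D.height false _) _ (2 * H + 1), recSeq_add_two, h0, h1] at h2
  have h3 : D.height (D.col i) (cs.geomRep (D.coxeter cs ^ H) (simpleRoot i)) = D.weight i := by
    rw [← (D.height_simpleRoot (D.col i) i).trans (if_pos rfl)]
    cases D.col i
    · rw [h2.1]; ring
    · rw [h2.2]; ring
  rcases ((cs.isRoot_simpleRoot i).geomRep (D.coxeter cs ^ H)).nonneg_or_nonpos with h | h
  · exact h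
  · have := D.height_nonneg (neg_nonneg.2 h) (D.col i)
    rw [height_neg, h3] at this
    linarith [D.weight_pos i]

theorem offset_le_one (i : B) : D.offset i ≤ 1 := by rw [offset]; split_ifs <;> simp

theorem eq_of_recSeq_eq {r : ℝ} {H : ℕ}
    (hmin : ∀ d, 0 < d → d < 2 * H → ¬ (recSeq r 0 1 d = 0 ∧ recSeq r 0 1 (d + 1) = 1))
    {m n : ℕ} (hm : m < 2 * H) (hn : n < 2 * H) (h0 : recSeq r 0 1 m = recSeq r 0 1 n)
    (h1 : recSeq r 0 1 (m + 1) = recSeq r 0 1 (n + 1)) : m = n := by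
  wlog hmn : m ≤ n generalizing m n
  · exact (this hn hm h0.symm h1.symm (le_of_not_ge hmn)).symm
  obtain ⟨d, rfl⟩ := Nat.exists_eq_add_of_le hmn
  by_contra hne
  exact hmin d (by omega) (by omega) (recSeq_eq_of_add_eq h0.symm h1.symm)

theorem geomRep_coxeter_pow_leader_injective [Finite W] [Nonempty B] {k k' : ℕ} {i i' : B}
    (hk : k < orderOf (D.coxeter cs)) (hk' : k' < orderOf (D.coxeter cs))
    (h : cs.geomRep (D.coxeter cs ^ k) (D.leader cs i) =
      cs.geomRep (D.coxeter cs ^ k') (D.leader cs i')) : k = k' ∧ i = i' := by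
  obtain ⟨H, hH, h0, h1, hmin⟩ := exists_recSeq_period (r := D.r) (D.recSeq_sign cs)
    ⟨_, by have := orderOf_pos (D.coxeter cs); omega, (D.recSeq_orderOf_coxeter cs).le⟩
  have hle := D.orderOf_coxeter_le cs hH h0 h1
  have ho := D.offset_le_one i
  have ho' := D.offset_le_one i'
  have e := D.height_coxeter_pow_leader cs k i
  rw [h, (D.height_coxeter_pow_leader cs k' i').1, (D.height_coxeter_pow_leader cs k' i').2] at e
  have inv := recSeq_invariant (r := D.r) (2 * k + D.offset i)
  have inv' := recSeq_invariant (r := D.r) (2 * k' + D.offset i')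
  have hp := D.weight_pos i
  have hw : D.weight i' = D.weight i := by
    refine (sq_eq_sq₀ (D.weight_pos i').le hp.le).1 ?_
    set a := recSeq D.r 0 1 (2 * k + D.offset i)
    set b := recSeq D.r 0 1 (2 * k + D.offset i + 1)
    set a' := recSeq D.r 0 1 (2 * k' + D.offset i')
    set b' := recSeq D.r 0 1 (2 * k' + D.offset i' + 1)
    calc D.weight i' ^ 2 = (D.weight i' * b') ^ 2 - D.r * (D.weight i' * b') * (D.weight i' * a')
          + (D.weight i' * a') ^ 2 := by linear_combination -D.weight i' ^ 2 * inv'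
      _ = D.weight i ^ 2 := by rw [e.1, e.2]; linear_combination D.weight i ^ 2 * inv
  rw [hw] at e
  have hN := eq_of_recSeq_eq hmin (by omega) (by omega) (mul_left_cancel₀ hp.ne' e.1)
    (mul_left_cancel₀ hp.ne' e.2)
  obtain rfl : k = k' := by omega
  have hoff : D.offset i = D.offset i' := by omega
  have hcol : D.col i = D.col i' := by
    simp only [offset] at hoff
    cases hi : D.col i <;> cases hi' : D.col i' <;> simp_all
  have hinj (w : W) : Function.Injective (cs.geomRep w) := fun x y hxy => by
    rw [← cs.geomRep_inv_apply w x, hxy, cs.geomRep_inv_apply]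
  have hl := hinj _ h
  have hs : (simpleRoot i : B → ℝ) = simpleRoot i' := by
    simp only [leader, hcol] at hl
    split_ifs at hl
    · exact hl
    · exact hinj _ hl
  refine ⟨rfl, ?_⟩
  by_contra hne
  have := congrFun hs i
  simp [simpleRoot_apply, hne] at this

theorem eq_simpleRoot_of_wordProd_inv_nonpos [Finite W] {ε : Bool} {l : List B} (hnd : l.Nodup)
    (hl : ∀ i ∈ l, D.col i = ε) {γ : B → ℝ} (hγ : cs.IsRoot γ) (h0 : 0 ≤ γ)
    (h1 : cs.geomRep (cs.wordProd l)⁻¹ γ ≤ 0) : ∃ i ∈ l, γ = simpleRoot i := by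
  induction l generalizing γ with
  | nil =>
    simp only [CoxeterSystem.wordProd_nil, inv_one, map_one, Module.End.one_apply] at h1
    exact absurd (le_antisymm h1 h0) hγ.ne_zero
  | cons j l ih =>
    rw [List.nodup_cons] at hnd
    rw [CoxeterSystem.wordProd_cons, mul_inv_rev, CoxeterSystem.inv_simple, map_mul,
      Module.End.mul_apply] at h1
    have hγ' := hγ.geomRep (cs.simple j)
    rcases hγ'.nonneg_or_nonpos with h | h
    · obtain ⟨i, hi, hi'⟩ := ih hnd.2 (fun i hi => hl i (List.mem_cons_of_mem _ hi)) hγ' h h1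
      refine ⟨i, List.mem_cons_of_mem _ hi, ?_⟩
      have hij : j ≠ i := by rintro rfl; exact hnd.1 hi
      have : cs.geomRep (cs.simple j) (cs.geomRep (cs.simple j) γ) = γ := by
        rw [← Module.End.mul_apply, ← map_mul, CoxeterSystem.simple_mul_simple_self, map_one,
          Module.End.one_apply]
      rw [← this, hi', CoxeterSystem.geomRep_simple, rootReflection_apply, form_simpleRoot_left]
      simp [simpleRoot_apply, D.gram_eq_zero j i hij
        ((hl j (by simp)).trans (hl i (List.mem_cons_of_mem _ hi)).symm)]
    · exact ⟨j, by simp, hγ.eq_simpleRoot h0 h⟩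

theorem eq_leader_of_coxeter_inv_nonpos [Finite W] {γ : B → ℝ} (hγ : cs.IsRoot γ) (h0 : 0 ≤ γ)
    (h1 : cs.geomRep (D.coxeter cs)⁻¹ γ ≤ 0) : ∃ i, γ = D.leader cs i := by
  rw [coxeter, mul_inv_rev, map_mul, Module.End.mul_apply] at h1
  have hγ' := hγ.geomRep (D.half cs true)⁻¹
  rcases hγ'.nonneg_or_nonpos with h | h
  · obtain ⟨i, hi, hi'⟩ := D.eq_simpleRoot_of_wordProd_inv_nonpos cs (D.nodup_word false)
      (fun i hi => D.mem_word.1 hi) hγ' h h1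
    refine ⟨i, ?_⟩
    rw [leader, if_neg (by simp [D.mem_word.1 hi]), ← hi', CoxeterSystem.geomRep_apply_inv]
  · obtain ⟨i, hi, hi'⟩ := D.eq_simpleRoot_of_wordProd_inv_nonpos cs (D.nodup_word true)
      (fun i hi => D.mem_word.1 hi) hγ h0 h
    exact ⟨i, by rw [leader, if_pos (D.mem_word.1 hi), hi']⟩

theorem nodup_word_append (ε : Bool) : (D.word ε ++ D.word (!ε)).Nodup := by
  refine (D.nodup_word ε).append (D.nodup_word _) fun i hi hi' => ?_
  rw [mem_word] at hi hi'
  simp [hi] at hi'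

theorem mem_word_append (ε : Bool) (i : B) : i ∈ D.word ε ++ D.word (!ε) := by
  simp only [List.mem_append, mem_word]
  exact Bool.eq_or_eq_not _ _

theorem coxeter_eq_wordProd : D.coxeter cs = cs.wordProd (D.word true ++ D.word (!true)) := by
  rw [CoxeterSystem.wordProd_append]; rfl

theorem sum_geomRep_coxeter_pow [Finite W] (x : B → ℝ) :
    ∑ k ∈ Finset.range (orderOf (D.coxeter cs)), cs.geomRep (D.coxeter cs ^ k) x = 0 := by
  refine cs.eq_zero_of_fixed (D.nodup_word_append true) ?_
    fun i hi => absurd (D.mem_word_append true i) hi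
  rw [← coxeter_eq_wordProd, map_sum]
  have h1 := Finset.sum_range_succ (fun k => cs.geomRep (D.coxeter cs ^ k) x)
    (orderOf (D.coxeter cs))
  rw [Finset.sum_range_succ', pow_orderOf_eq_one, pow_zero] at h1
  simpa only [← Module.End.mul_apply, ← map_mul, ← pow_succ'] using add_right_cancel h1

theorem exists_coxeter_pow_leader_eq [Finite W] {β : B → ℝ} (hβ : cs.IsRoot β) :
    ∃ k < orderOf (D.coxeter cs), ∃ i, cs.geomRep (D.coxeter cs ^ k) (D.leader cs i) = β := by
  classical
  have not_all {x : B → ℝ} (hx : cs.IsRoot x) : ¬ ∀ k, 0 ≤ cs.geomRep (D.coxeter cs ^ k) x := by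
    intro h
    have h1 := (Finset.sum_eq_zero_iff_of_nonneg fun k _ => h k).1
      (D.sum_geomRep_coxeter_pow cs x) 0 (Finset.mem_range.2 (orderOf_pos _))
    exact hx.ne_zero (by simpa using h1)
  have key : ∃ k, cs.geomRep (D.coxeter cs ^ k) β ≤ 0 ∧
      0 ≤ cs.geomRep (D.coxeter cs ^ (k + 1)) β := by
    by_contra! hcon
    obtain ⟨k₀, hk₀⟩ := not_forall.1 (not_all hβ)
    have hneg := (hβ.geomRep (D.coxeter cs ^ k₀)).nonneg_or_nonpos.resolve_left hk₀
    have hall : ∀ k, cs.geomRep (D.coxeter cs ^ (k + k₀)) β ≤ 0 := by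
      intro k
      induction k with
      | zero => simpa using hneg
      | succ k ih =>
        rw [add_right_comm]
        exact (hβ.geomRep (D.coxeter cs ^ (k + k₀ + 1))).nonneg_or_nonpos.resolve_left (hcon _ ih)
    refine not_all (hβ.geomRep (D.coxeter cs ^ k₀)).neg fun k => ?_
    rw [map_neg, neg_nonneg, ← Module.End.mul_apply, ← map_mul, ← pow_add]
    exact hall k
  obtain ⟨k, hk, hk'⟩ := key
  obtain ⟨i, hi⟩ := D.eq_leader_of_coxeter_inv_nonpos cs (hβ.geomRep _) hk' (by
    rwa [pow_succ', map_mul, Module.End.mul_apply, CoxeterSystem.geomRep_inv_apply])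
  have hmem : (D.coxeter cs ^ (k + 1))⁻¹ ∈ Subgroup.zpowers (D.coxeter cs) :=
    inv_mem (pow_mem (Subgroup.mem_zpowers _) _)
  rw [mem_zpowers_iff_mem_range_orderOf, Finset.mem_image] at hmem
  obtain ⟨m, hm, hm'⟩ := hmem
  refine ⟨m, Finset.mem_range.1 hm, i, ?_⟩
  rw [hm', ← hi, CoxeterSystem.geomRep_inv_apply]

end BipartiteEigenvector

end CoxeterMatrix

namespace CoxeterMatrix

namespace BipartiteEigenvector

variable {B : Type*} [Fintype B] [DecidableEq B] {M : CoxeterMatrix B} (D : BipartiteEigenvector M)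
variable {W : Type*} [Group W] (cs : CoxeterSystem M W)

/-- An element sending the simple root of a vertex to its leader. -/
noncomputable def leaderElt (i : B) : W := if D.col i = true then 1 else D.half cs true

theorem leader_eq (i : B) : D.leader cs i = cs.geomRep (D.leaderElt cs i) (simpleRoot i) := by
  rw [leader, leaderElt]
  split_ifs <;> simp

/-- The reflection in the `k`-th element of the orbit of the `i`-th leader. -/
noncomputable def orbitReflection (p : Fin (orderOf (D.coxeter cs)) × B) : W :=
  (D.coxeter cs ^ (p.1 : ℕ) * D.leaderElt cs p.2) * cs.simple p.2 *
    (D.coxeter cs ^ (p.1 : ℕ) * D.leaderElt cs p.2)⁻¹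

theorem geomRep_orbitReflection (p : Fin (orderOf (D.coxeter cs)) × B) :
    cs.geomRep (D.orbitReflection cs p) =
      M.rootReflection (cs.geomRep (D.coxeter cs ^ (p.1 : ℕ)) (D.leader cs p.2)) := by
  rw [orbitReflection, CoxeterSystem.geomRep_conj_simple, map_mul, Module.End.mul_apply, leader_eq]

theorem isReflectionOf_orbitReflection (p : Fin (orderOf (D.coxeter cs)) × B) :
    IsReflectionOf (simpleSet cs) (D.orbitReflection cs p) := ⟨_, _, ⟨p.2, rfl⟩, rfl⟩

open Classical in
theorem card_filter_orbitReflection [Finite W] [Nonempty B] {t : W}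
    (ht : IsReflectionOf (simpleSet cs) t) :
    (Finset.univ.filter fun p => D.orbitReflection cs p = t).card = 2 := by
  obtain ⟨β, hβ, hβt⟩ := cs.exists_root_of_isReflectionOf ht
  obtain ⟨k, hk, i, hi⟩ := D.exists_coxeter_pow_leader_eq cs hβ
  obtain ⟨k', hk', i', hi'⟩ := D.exists_coxeter_pow_leader_eq cs hβ.neg
  have hneg : M.rootReflection (-β) = M.rootReflection β := LinearMap.ext fun x => by
    rw [rootReflection_apply, rootReflection_apply, map_neg, LinearMap.neg_apply]
    simp
  rw [Finset.card_eq_two]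
  refine ⟨(⟨k, hk⟩, i), (⟨k', hk'⟩, i'), fun h => ?_, ?_⟩
  · simp only [Prod.mk.injEq, Fin.mk.injEq] at h
    obtain ⟨rfl, rfl⟩ := h
    exact hβ.ne_zero (self_eq_neg.1 (hi.symm.trans hi'))
  · ext ⟨⟨m, hm⟩, j⟩
    simp only [Finset.mem_filter, Finset.mem_univ, true_and, Finset.mem_insert,
      Finset.mem_singleton, Prod.mk.injEq, Fin.mk.injEq]
    rw [← cs.geomRep_injective.eq_iff, geomRep_orbitReflection, hβt]
    constructor
    · intro h
      rcases CoxeterSystem.rootReflection_injOn hβ.form_self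
        ((D.isRoot_leader cs j).geomRep (D.coxeter cs ^ m)).form_self h.symm with h | h
      · exact Or.inl (D.geomRep_coxeter_pow_leader_injective cs hm hk (h.trans hi.symm))
      · exact Or.inr (D.geomRep_coxeter_pow_leader_injective cs hm hk' (h.trans hi'.symm))
    · rintro (⟨rfl, rfl⟩ | ⟨rfl, rfl⟩)
      · rw [hi]
      · rw [hi', hneg]

theorem wordProd_eq_of_perm [Finite W] {ε : Bool} {l l' : List B} (hnd : l.Nodup)
    (hl : ∀ i ∈ l, D.col i = ε) (hp : l.Perm l') : cs.wordProd l = cs.wordProd l' := by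
  refine cs.geomRep_injective (LinearMap.ext fun x => funext fun j => ?_)
  rw [D.geomRep_wordProd_apply cs hnd hl,
    D.geomRep_wordProd_apply cs (hp.nodup hnd) fun i hi => hl i (hp.mem_iff.2 hi)]
  simp only [hp.mem_iff]

/-- A word for a Coxeter element of a maximal standard parabolic subgroup. -/
noncomputable def parabolicWord (i : B) : List B :=
  (D.word (D.col i)).erase i ++ D.word (!D.col i)

theorem mem_parabolicWord {i j : B} : j ∈ D.parabolicWord i ↔ j ≠ i := by
  rw [parabolicWord, List.mem_append, (D.nodup_word _).mem_erase_iff, mem_word, mem_word]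
  by_cases h : j = i
  · subst h; simp
  · simp [h, Bool.eq_or_eq_not]

theorem nodup_parabolicWord (i : B) : (D.parabolicWord i).Nodup :=
  (D.nodup_word_append (D.col i)).sublist (List.erase_sublist.append_right _)

theorem wordProd_parabolicWord [Finite W] (i : B) :
    cs.wordProd (D.parabolicWord i) =
      cs.simple i * (D.half cs (D.col i) * D.half cs (!D.col i)) := by
  have h : D.half cs (D.col i) = cs.wordProd (i :: (D.word (D.col i)).erase i) :=
    D.wordProd_eq_of_perm cs (D.nodup_word _) (fun j hj => D.mem_word.1 hj)
      (List.perm_cons_erase (D.mem_word.2 rfl))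
  rw [h, parabolicWord, CoxeterSystem.wordProd_append, CoxeterSystem.wordProd_cons, half]
  simp [mul_assoc]

theorem isConj_coxeter_mul_orbitReflection [Finite W] (p : Fin (orderOf (D.coxeter cs)) × B) :
    IsConj (D.coxeter cs * D.orbitReflection cs p) (cs.wordProd (D.parabolicWord p.2)) := by
  rw [wordProd_parabolicWord, isConj_iff]
  obtain ⟨k, i⟩ := p
  have hk : D.coxeter cs * D.coxeter cs ^ (k : ℕ) = D.coxeter cs ^ (k : ℕ) * D.coxeter cs :=
    (Commute.self_pow _ _).eq
  refine ⟨cs.simple i * (D.coxeter cs ^ (k : ℕ) * D.leaderElt cs i)⁻¹, ?_⟩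
  have hs : cs.simple i * (cs.simple i)⁻¹ = 1 := mul_inv_cancel _
  have hs' := cs.simple_mul_simple_self i
  calc _ = cs.simple i * (D.leaderElt cs i)⁻¹ * (D.coxeter cs ^ (k : ℕ))⁻¹ *
        (D.coxeter cs * D.coxeter cs ^ (k : ℕ)) * D.leaderElt cs i *
        (cs.simple i * (cs.simple i)⁻¹) := by
        simp only [orbitReflection]; group
    _ = cs.simple i * ((D.leaderElt cs i)⁻¹ * D.coxeter cs * D.leaderElt cs i) := by
        rw [hk]; group
    _ = _ := by
        dsimp only
        rw [leaderElt, coxeter]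
        cases D.col i <;> simp

theorem two_mul_factorizationCount_coxeter [Finite W] [Nonempty B] (n : ℕ) :
    2 * factorizationCount (simpleSet cs) (n + 1) (D.coxeter cs) =
      orderOf (D.coxeter cs) *
        ∑ i, factorizationCount (simpleSet cs) n (cs.wordProd (D.parabolicWord i)) := by
  classical
  calc _ = ∑ t ∈ reflectionFinset (simpleSet cs),
        2 * factorizationCount (simpleSet cs) n (D.coxeter cs * t) := by
        rw [factorizationCount, Finset.mul_sum]
    _ = ∑ t ∈ reflectionFinset (simpleSet cs), ∑ p with D.orbitReflection cs p = t,
        factorizationCount (simpleSet cs) n (cs.wordProd (D.parabolicWord p.2)) := by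
        refine Finset.sum_congr rfl fun t ht => ?_
        rw [mem_reflectionFinset] at ht
        rw [← D.card_filter_orbitReflection cs ht, ← smul_eq_mul, ← Finset.sum_const]
        refine Finset.sum_congr rfl fun p hp => ?_
        rw [← (Finset.mem_filter.1 hp).2]
        exact factorizationCount_eq_of_isConj (D.isConj_coxeter_mul_orbitReflection cs p) n
    _ = ∑ p : Fin (orderOf (D.coxeter cs)) × B,
        factorizationCount (simpleSet cs) n (cs.wordProd (D.parabolicWord p.2)) :=
        Finset.sum_fiberwise_of_maps_to
          (fun p _ => mem_reflectionFinset.2 (D.isReflectionOf_orbitReflection cs p)) _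
    _ = _ := by rw [Fintype.sum_prod_type]; simp

end BipartiteEigenvector

end CoxeterMatrix

open CoxeterMatrix in
theorem CoxeterSystem.exists_bipartiteEigenvector {B W : Type*} [Fintype B] [DecidableEq B]
    [Group W] [Finite W] {M : CoxeterMatrix B} (cs : CoxeterSystem M W)
    (hirr : IsIrreducibleCS cs) : Nonempty (BipartiteEigenvector M) := by
  obtain ⟨col, hcol⟩ := cs.hasLeaves.exists_two_coloring
    (fun a b h => by rw [M.symmetric]; exact h)
  obtain ⟨p, r, hp, he⟩ := cs.exists_pos_eigenvector hirr
  refine ⟨⟨col, p, r, fun i j hij hc => ?_, hp, he⟩⟩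
  have : M i j = 2 := by
    by_contra h
    exact hcol i j hij h hc
  simp [gram, this]

/-- **Corollary (recursion for maximal chains).**
If `(W,S)` is a finite irreducible Coxeter system of rank `n` with Coxeter number `h`,
then `2·MC(W) = h · ∑_{s∈S} MC(W_⟨s⟩)`. -/
theorem max_chain_recursion
    {B : Type} [Fintype B] {W : Type} [Group W] [Fintype W]
    {M : CoxeterMatrix B} (cs : CoxeterSystem M W)
    (hirr : IsIrreducibleCS cs)
    (c : W) (hc : IsCoxeterElementOf (simpleSet cs) c)
    (h : ℕ) (hh : h = orderOf c)
    (c' : ∀ s : B, parabolic cs s)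
    (hc' : ∀ s : B, IsCoxeterElementOf (parabolicGens cs s) (c' s)) :
    2 * maxChainCount (simpleSet cs) c (Fintype.card B) =
      h * ∑ s : B, maxChainCount (parabolicGens cs s) (c' s) (Fintype.card B - 1) := by
  classical
  subst hh
  have : Nonempty B := hirr.1
  obtain ⟨D⟩ := cs.exists_bipartiteEigenvector hirr
  obtain ⟨l, hnd, hmem, rfl⟩ := cs.exists_word_of_isCoxeterElementOf hc
  have hlen : Fintype.card B = l.length := by
    rw [← List.toFinset_card_of_nodup hnd, ← Finset.card_univ]
    congr 1; ext i; simp [hmem]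
  have hconj : IsConj (cs.wordProd l) (D.coxeter cs) := by
    rw [D.coxeter_eq_wordProd]
    exact cs.isConj_wordProd_of_perm hnd ((List.perm_ext_iff_of_nodup hnd
      (D.nodup_word_append true)).2 fun i => iff_of_true (hmem i) (D.mem_word_append true i))
  have hlen' (s : B) : Fintype.card B - 1 = (D.parabolicWord s).length := by
    rw [← List.toFinset_card_of_nodup (D.nodup_parabolicWord s), ← Finset.card_univ,
      ← Finset.card_erase_of_mem (Finset.mem_univ s)]
    congr 1; ext i; simp [D.mem_parabolicWord]
  have hsum : ∑ s : B, maxChainCount (parabolicGens cs s) (c' s) (Fintype.card B - 1) =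
      ∑ s : B, factorizationCount (simpleSet cs) (Fintype.card B - 1)
        (cs.wordProd (D.parabolicWord s)) :=
    Finset.sum_congr rfl fun s _ => by
      rw [hlen' s]
      exact cs.maxChainCount_parabolicGens (hc' s) (D.nodup_parabolicWord s)
        fun i => D.mem_parabolicWord
  have horder : orderOf (cs.wordProd l) = orderOf (D.coxeter cs) := by
    obtain ⟨g, hg⟩ := isConj_iff.1 hconj
    rw [← hg]
    exact (MulEquiv.orderOf_eq (MulAut.conj g) _).symm
  rw [hsum, horder, ← D.two_mul_factorizationCount_coxeter cs,
    Nat.sub_add_cancel Fintype.card_pos, hlen, cs.maxChainCount_simpleSet hnd,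
    factorizationCount_eq_of_isConj hconj]
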